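/- arXiv:1911.13284 — 2 statements merged into one kernel-verified Lean document; each statement's English description precedes it below -/
import Mathlib

section
/- Let n ≥ 2 and let q be a prime power such that G := PSL_n(q) is a simple group. Then for every nontrivial irreducible character α of G, diam M(G,α) ≤ 489·(n−1)²; that is, for all irreducible characters χ₁, χ₂ of G there exists an integer j with 0 ≤ j ≤ 489·(n−1)² such that [α^j·χ₁, χ₂]_G ≠ 0. (This is the case of projective special linear groups, of rank n−1, of the theorem that diam M(G,α) ≤ C·r² for any finite simple group G of Lie type of rank r, with C = 489.) -/
open scoped BigOperators

/-- The inner product `[φ,ψ]_G = (1/|G|) ∑_{g∈G} φ(g)·conj(ψ(g))` of two complex-valued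
functions on a group `G`. -/
noncomputable def charInner {G : Type} [Group G] (φ ψ : G → ℂ) : ℂ :=
  (Nat.card G : ℂ)⁻¹ * ∑ᶠ g : G, φ g * (starRingEnd ℂ) (ψ g)

/-- `χ` is the character of some finite-dimensional complex representation of `G`. -/
def IsChar (G : Type) [Group G] (χ : G → ℂ) : Prop :=
  ∃ V : FDRep ℂ G, ∀ g, V.character g = χ g

/-- `χ` is the character of some irreducible finite-dimensional complex representation of `G`. -/
def IsIrrChar (G : Type) [Group G] (χ : G → ℂ) : Prop :=
  ∃ V : FDRep ℂ G, CategoryTheory.Simple V ∧ ∀ g, V.character g = χ g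

/-- `χ` is a character of `G` afforded by a faithful (injective) representation. -/
def IsFaithfulChar (G : Type) [Group G] (χ : G → ℂ) : Prop :=
  ∃ V : FDRep ℂ G, Function.Injective (fun g => V.ρ g) ∧ ∀ g, V.character g = χ g

/-- The McKay graph `M(G, α)` has diameter at most `d`: for every ordered pair of
irreducible characters `χ₁, χ₂` there is `0 ≤ j ≤ d` with `[α^j·χ₁, χ₂]_G ≠ 0`. -/
def McKayDiamLE (G : Type) [Group G] (α : G → ℂ) (d : ℕ) : Prop :=
  ∀ χ₁ χ₂ : G → ℂ, IsIrrChar G χ₁ → IsIrrChar G χ₂ →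
    ∃ j ≤ d, charInner (α ^ j * χ₁) χ₂ ≠ 0

open scoped MatrixGroups

section

open Matrix

section UnitaryMatrices

variable {ι : Type*} [Fintype ι]

theorem norm_trace_conjTranspose_mul_sq_le (A B : Matrix ι ι ℂ) :
    ‖(Aᴴ * B).trace‖ ^ 2 ≤ (Aᴴ * A).trace.re * (Bᴴ * B).trace.re := by
  have key (C : Matrix ι ι ℂ) :
      (Cᴴ * C).trace.re = ∑ p : ι × ι, ‖C p.1 p.2‖ ^ 2 := by
    rw [Fintype.sum_prod_type_right]
    simp only [trace, diag_apply, mul_apply, conjTranspose_apply, Complex.re_sum]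
    refine Finset.sum_congr rfl fun i _ => Finset.sum_congr rfl fun j _ => ?_
    rw [RCLike.star_def, Complex.conj_mul', ← Complex.ofReal_pow, Complex.ofReal_re]
  rw [key, key]
  have h : ‖(Aᴴ * B).trace‖ ≤ ∑ p : ι × ι, ‖A p.1 p.2‖ * ‖B p.1 p.2‖ := by
    rw [Fintype.sum_prod_type_right]
    simp only [trace, diag_apply, mul_apply, conjTranspose_apply]
    refine (norm_sum_le _ _).trans (Finset.sum_le_sum fun i _ => ?_)
    refine (norm_sum_le _ _).trans (Finset.sum_le_sum fun j _ => ?_)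
    rw [norm_mul, norm_star]
  exact (pow_le_pow_left₀ (norm_nonneg _) h 2).trans
    (Finset.sum_mul_sq_le_sq_mul_sq _ _ _)

variable [DecidableEq ι]

theorem trace_eq_finrank_range_of_isIdempotentElem {P : Matrix ι ι ℂ} (hP : P * P = P) :
    P.trace = Module.finrank ℂ (LinearMap.range (toLin' P)) := by
  have h : IsIdempotentElem (toLin' P) := by
    rw [IsIdempotentElem, Module.End.mul_eq_comp, ← toLin'_mul, hP]
  rw [← (LinearMap.IsIdempotentElem.isProj_range _ h).trace, trace_toLin'_eq]

theorem mem_range_toLin'_iff {P : Matrix ι ι ℂ} (hP : P * P = P) (v : ι → ℂ) :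
    v ∈ LinearMap.range (toLin' P) ↔ P *ᵥ v = v := by
  constructor
  · rintro ⟨w, rfl⟩
    simp [mulVec_mulVec, hP]
  · intro h
    exact ⟨v, by simpa using h⟩

theorem one_le_trace_re_of_isIdempotentElem {P : Matrix ι ι ℂ} (hP : P * P = P) (h0 : P ≠ 0) :
    1 ≤ P.trace.re := by
  rw [trace_eq_finrank_range_of_isIdempotentElem hP, Complex.natCast_re]
  rw [Nat.one_le_cast, Nat.one_le_iff_ne_zero]
  intro h
  rw [Submodule.finrank_eq_zero, LinearMap.range_eq_bot] at h
  exact h0 (by simpa using h)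

theorem trace_re_nonneg_of_isIdempotentElem {P : Matrix ι ι ℂ} (hP : P * P = P) :
    0 ≤ P.trace.re := by
  rw [trace_eq_finrank_range_of_isIdempotentElem hP, Complex.natCast_re]
  positivity

section Average

variable {H : Type*} [Group H] [Fintype H]

/-- The average of a matrix representation of a finite group. -/
noncomputable def avgMatrix (τ : H →* Matrix ι ι ℂ) : Matrix ι ι ℂ :=
  (Fintype.card H : ℂ)⁻¹ • ∑ h, τ h

theorem mul_avgMatrix (τ : H →* Matrix ι ι ℂ) (h : H) : τ h * avgMatrix τ = avgMatrix τ := by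
  rw [avgMatrix, mul_smul_comm, Finset.mul_sum]
  simp_rw [← map_mul]
  congr 1
  exact Fintype.sum_equiv (Equiv.mulLeft h) _ _ fun x => rfl

theorem avgMatrix_mul (τ : H →* Matrix ι ι ℂ) (h : H) : avgMatrix τ * τ h = avgMatrix τ := by
  rw [avgMatrix, smul_mul_assoc, Finset.sum_mul]
  simp_rw [← map_mul]
  congr 1
  exact Fintype.sum_equiv (Equiv.mulRight h) _ _ fun x => rfl

theorem avgMatrix_mul_of_forall {τ : H →* Matrix ι ι ℂ} {v : ι → ℂ}
    (hv : ∀ h, τ h *ᵥ v = v) : avgMatrix τ *ᵥ v = v := by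
  have hc : (Fintype.card H : ℂ) ≠ 0 := Nat.cast_ne_zero.2 Fintype.card_ne_zero
  rw [avgMatrix, smul_mulVec, sum_mulVec]
  simp [hv, ← Nat.cast_smul_eq_nsmul ℂ, smul_smul, hc]

theorem avgMatrix_mul_self (τ : H →* Matrix ι ι ℂ) : avgMatrix τ * avgMatrix τ = avgMatrix τ := by
  have hc : (Fintype.card H : ℂ) ≠ 0 := Nat.cast_ne_zero.2 Fintype.card_ne_zero
  nth_rw 1 [avgMatrix]
  rw [smul_mul_assoc, Finset.sum_mul]
  simp [mul_avgMatrix, ← Nat.cast_smul_eq_nsmul ℂ, smul_smul, hc]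

theorem avgMatrix_mulVec_eq_iff (τ : H →* Matrix ι ι ℂ) (v : ι → ℂ) :
    avgMatrix τ *ᵥ v = v ↔ ∀ h, τ h *ᵥ v = v := by
  refine ⟨fun hv h => ?_, avgMatrix_mul_of_forall⟩
  rw [← hv, mulVec_mulVec, mul_avgMatrix]

theorem conjTranspose_avgMatrix {τ : H →* Matrix ι ι ℂ} (hτ : ∀ h, (τ h)ᴴ = τ h⁻¹) :
    (avgMatrix τ)ᴴ = avgMatrix τ := by
  rw [avgMatrix, conjTranspose_smul, conjTranspose_sum]
  simp_rw [hτ]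
  congr 1
  · simp
  · exact Fintype.sum_equiv (Equiv.inv H) _ _ fun x => rfl

theorem trace_avgMatrix (τ : H →* Matrix ι ι ℂ) :
    (avgMatrix τ).trace = (Fintype.card H : ℂ)⁻¹ * ∑ h, (τ h).trace := by
  rw [avgMatrix, trace_smul, trace_sum, smul_eq_mul]

/-- If the vectors fixed by both of two commuting pairs of averages are zero-dimensional up to a
submodule `S`, the traces add up to at most the ambient trace. -/
theorem trace_add_trace_le {P Q R : Matrix ι ι ℂ} (hP : P * P = P) (hQ : Q * Q = Q)
    (hR : R * R = R) (hRP : R * P = P) (hRQ : R * Q = Q) (S : Submodule ℂ (ι → ℂ))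
    (hS : ∀ v, P *ᵥ v = v → Q *ᵥ v = v → v ∈ S) :
    P.trace.re + Q.trace.re ≤ R.trace.re + Module.finrank ℂ S := by
  rw [trace_eq_finrank_range_of_isIdempotentElem hP, trace_eq_finrank_range_of_isIdempotentElem hQ,
    trace_eq_finrank_range_of_isIdempotentElem hR]
  simp only [Complex.natCast_re]
  norm_cast
  rw [← Submodule.finrank_sup_add_finrank_inf_eq]
  refine add_le_add (Submodule.finrank_mono (sup_le ?_ ?_)) (Submodule.finrank_mono ?_)
  · intro v hv
    rw [mem_range_toLin'_iff hP] at hv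
    rw [mem_range_toLin'_iff hR, ← hv, mulVec_mulVec, hRP]
  · intro v hv
    rw [mem_range_toLin'_iff hQ] at hv
    rw [mem_range_toLin'_iff hR, ← hv, mulVec_mulVec, hRQ]
  · rintro v ⟨h1, h2⟩
    exact hS v ((mem_range_toLin'_iff hP v).1 h1) ((mem_range_toLin'_iff hQ v).1 h2)

end Average

section Isotypic

variable {A : Type*} [AddCommGroup A]

/-- The twist of a matrix representation of an abelian group by the inverse of a character. -/
noncomputable def twist (τ : Multiplicative A →* Matrix ι ι ℂ) (l : AddChar A ℂ) :
    Multiplicative A →* Matrix ι ι ℂ where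
  toFun a := l (-a.toAdd) • τ a
  map_one' := by simp
  map_mul' a b := by
    simp [AddChar.map_add_eq_mul, smul_smul, mul_comm]

theorem twist_apply (τ : Multiplicative A →* Matrix ι ι ℂ) (l : AddChar A ℂ)
    (a : Multiplicative A) : twist τ l a = l (-a.toAdd) • τ a := rfl

theorem twist_zero (τ : Multiplicative A →* Matrix ι ι ℂ) : twist τ 0 = τ := by
  refine MonoidHom.ext fun a => ?_
  simp [twist_apply]

variable [Fintype A]

theorem conjTranspose_twist {τ : Multiplicative A →* Matrix ι ι ℂ} (hτ : ∀ a, (τ a)ᴴ = τ a⁻¹)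
    (l : AddChar A ℂ) (a : Multiplicative A) : (twist τ l a)ᴴ = twist τ l a⁻¹ := by
  rw [twist_apply, twist_apply, conjTranspose_smul, hτ, toAdd_inv, neg_neg]
  congr 1
  rw [AddChar.map_neg_eq_conj]
  simp

/-- The projection onto the `l`-isotypic part. -/
noncomputable def isoProj (τ : Multiplicative A →* Matrix ι ι ℂ) (l : AddChar A ℂ) :
    Matrix ι ι ℂ := avgMatrix (twist τ l)

theorem isoProj_mul_self (τ : Multiplicative A →* Matrix ι ι ℂ) (l : AddChar A ℂ) :
    isoProj τ l * isoProj τ l = isoProj τ l := avgMatrix_mul_self _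

theorem mul_isoProj (τ : Multiplicative A →* Matrix ι ι ℂ) (l : AddChar A ℂ) (a : A) :
    τ (.ofAdd a) * isoProj τ l = l a • isoProj τ l := by
  have h := mul_avgMatrix (twist τ l) (.ofAdd a)
  rw [twist_apply, toAdd_ofAdd] at h
  rw [isoProj]
  nth_rw 2 [← h]
  rw [smul_mul_assoc, smul_smul, ← AddChar.map_add_eq_mul]
  simp

theorem isoProj_mul (τ : Multiplicative A →* Matrix ι ι ℂ) (l : AddChar A ℂ) (a : A) :
    isoProj τ l * τ (.ofAdd a) = l a • isoProj τ l := by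
  have h := avgMatrix_mul (twist τ l) (.ofAdd a)
  rw [twist_apply, toAdd_ofAdd] at h
  rw [isoProj]
  nth_rw 2 [← h]
  rw [mul_smul_comm, smul_smul, ← AddChar.map_add_eq_mul]
  simp

theorem isoProj_mul_isoProj_of_ne (τ : Multiplicative A →* Matrix ι ι ℂ) {l m : AddChar A ℂ}
    (h : l ≠ m) : isoProj τ l * isoProj τ m = 0 := by
  obtain ⟨a, ha⟩ := DFunLike.ne_iff.1 h
  have h1 : l a • (isoProj τ l * isoProj τ m) = m a • (isoProj τ l * isoProj τ m) := by
    rw [← smul_mul_assoc, ← isoProj_mul, mul_assoc, mul_isoProj, mul_smul_comm]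
  rw [← sub_eq_zero, ← sub_smul] at h1
  exact (smul_eq_zero.1 h1).resolve_left (sub_ne_zero.2 ha)

theorem sum_isoProj (τ : Multiplicative A →* Matrix ι ι ℂ) :
    ∑ l : AddChar A ℂ, isoProj τ l = 1 := by
  classical
  have hc : (Fintype.card A : ℂ) ≠ 0 := Nat.cast_ne_zero.2 Fintype.card_ne_zero
  simp only [isoProj, avgMatrix, twist_apply]
  rw [← Finset.smul_sum, Finset.sum_comm]
  simp_rw [← Finset.sum_smul, AddChar.sum_apply_eq_ite]
  rw [Finset.sum_eq_single 1]
  · simp [hc]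
  · intro b _ hb
    rw [if_neg, zero_smul]
    simpa using hb
  · simp

theorem isoProj_conj (τ : Multiplicative A →* Matrix ι ι ℂ) {l m : AddChar A ℂ}
    {X Y : Matrix ι ι ℂ} (φ : A ≃ A)
    (hφ : ∀ a, X * τ (.ofAdd a) * Y = τ (.ofAdd (φ a))) (hl : ∀ a, m (-φ a) = l (-a)) :
    X * isoProj τ l * Y = isoProj τ m := by
  simp only [isoProj, avgMatrix, twist_apply]
  rw [mul_smul_comm, smul_mul_assoc, Finset.mul_sum, Finset.sum_mul]
  congr 1
  refine Fintype.sum_equiv (Multiplicative.toAdd.trans (φ.trans Multiplicative.ofAdd)) _ _ ?_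
  intro a
  simp only [Equiv.trans_apply, toAdd_ofAdd]
  rw [hl, ← hφ, mul_smul_comm, smul_mul_assoc]
  rfl

theorem conjTranspose_isoProj {τ : Multiplicative A →* Matrix ι ι ℂ} (hτ : ∀ a, (τ a)ᴴ = τ a⁻¹)
    (l : AddChar A ℂ) : (isoProj τ l)ᴴ = isoProj τ l :=
  conjTranspose_avgMatrix (conjTranspose_twist hτ l)

end Isotypic

end UnitaryMatrices

section UnitaryRepresentations

variable {ι : Type*} [Fintype ι] [DecidableEq ι]

section Bounds

variable {G : Type*} [Group G] {σ : G →* Matrix ι ι ℂ}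

theorem trace_conj_eq (σ : G →* Matrix ι ι ℂ) (g h : G) :
    (σ (h * g * h⁻¹)).trace = (σ g).trace := by
  rw [map_mul, map_mul, trace_mul_cycle, ← map_mul, inv_mul_cancel, map_one, one_mul]

variable (hσ : ∀ g, (σ g)ᴴ = σ g⁻¹)

include hσ

theorem trace_inv_eq (g : G) : (σ g⁻¹).trace = starRingEnd ℂ (σ g).trace := by
  rw [← hσ, trace_conjTranspose]
  rfl

theorem norm_trace_le_card (g : G) : ‖(σ g).trace‖ ≤ Fintype.card ι := by
  have h := norm_trace_conjTranspose_mul_sq_le (1 : Matrix ι ι ℂ) (σ g)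
  rw [hσ, ← map_mul, inv_mul_cancel, map_one] at h
  simp only [conjTranspose_one, one_mul, trace_one, Complex.natCast_re] at h
  rw [← sq] at h
  exact le_of_sq_le_sq h (by positivity)

theorem norm_trace_sq_le_sum_commutator {H : Type*} [Group H] [Fintype H] (ψ : H →* G) (g : G) :
    ‖(σ g).trace‖ ^ 2 ≤ Fintype.card ι *
      ((Fintype.card H : ℝ)⁻¹ * ∑ h, ‖(σ (g * ψ h * g⁻¹ * (ψ h)⁻¹)).trace‖) := by
  set T : Matrix ι ι ℂ := ∑ h, σ (ψ h * g * (ψ h)⁻¹) with hT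
  have hc : (0 : ℝ) < Fintype.card H := by exact_mod_cast Fintype.card_pos
  have htr : T.trace = Fintype.card H * (σ g).trace := by
    simp_rw [hT, trace_sum, trace_conj_eq]
    simp
  have hconj (k : H) : σ (ψ k)⁻¹ * T * σ (ψ k) = T := by
    rw [hT, Finset.mul_sum, Finset.sum_mul]
    simp_rw [← map_mul]
    refine Fintype.sum_equiv (Equiv.mulLeft k⁻¹) _ _ fun h => ?_
    simp [mul_assoc]
  have hTT : (Tᴴ * T).trace = Fintype.card H * ∑ h, (σ (g⁻¹ * ψ h * g * (ψ h)⁻¹)).trace := by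
    nth_rw 1 [hT]
    rw [conjTranspose_sum, Finset.sum_mul, trace_sum]
    have h1 (h : H) : ((σ (ψ h * g * (ψ h)⁻¹))ᴴ * T).trace = (σ g⁻¹ * T).trace := by
      rw [hσ, show (ψ h * g * (ψ h)⁻¹)⁻¹ = ψ h * g⁻¹ * (ψ h)⁻¹ by group, map_mul, map_mul,
        mul_assoc, mul_assoc, trace_mul_comm, mul_assoc, hconj]
    simp_rw [h1]
    rw [Finset.sum_const, Finset.card_univ, nsmul_eq_mul, hT, Finset.mul_sum, trace_sum]
    simp_rw [← map_mul, mul_assoc]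
  have hn (h : H) : ‖(σ (g⁻¹ * ψ h * g * (ψ h)⁻¹)).trace‖ =
      ‖(σ (g * ψ h * g⁻¹ * (ψ h)⁻¹)).trace‖ := by
    rw [show g * ψ h * g⁻¹ * (ψ h)⁻¹ = g * (g⁻¹ * ψ h * g * (ψ h)⁻¹)⁻¹ * g⁻¹ by group,
      trace_conj_eq, trace_inv_eq hσ, RCLike.norm_conj]
  have h := norm_trace_conjTranspose_mul_sq_le (1 : Matrix ι ι ℂ) T
  rw [hTT, conjTranspose_one, one_mul, one_mul, trace_one, htr, norm_mul, Complex.natCast_re,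
    Complex.norm_natCast, mul_pow] at h
  have h2 : (∑ h, (σ (g⁻¹ * ψ h * g * (ψ h)⁻¹)).trace).re ≤
      ∑ h, ‖(σ (g * ψ h * g⁻¹ * (ψ h)⁻¹)).trace‖ := by
    simp_rw [← hn]
    exact (Complex.re_le_norm _).trans (norm_sum_le _ _)
  rw [← Complex.ofReal_natCast (Fintype.card H), Complex.re_ofReal_mul] at h
  have h3 := h.trans (mul_le_mul_of_nonneg_left (mul_le_mul_of_nonneg_left h2 hc.le)
    (Nat.cast_nonneg _))
  rw [← mul_le_mul_iff_right₀ (pow_pos hc 2)]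
  refine h3.trans (le_of_eq ?_)
  field_simp

end Bounds

section Scaling

variable {F : Type*} [Field F] [Fintype F]

theorem card_sub_one_le_of_scaling (τ : Multiplicative F →* Matrix ι ι ℂ)
    (X Y : F → Matrix ι ι ℂ) (hXY : ∀ a ≠ 0, X a * Y a = 1)
    (hX : ∀ a ≠ 0, ∀ s, X a * τ (.ofAdd s) * Y a = τ (.ofAdd (a ^ 2 * s)))
    (hτ : ∃ s, τ s ≠ 1) : (Fintype.card F : ℝ) - 1 ≤ 2 * Fintype.card ι := by
  classical
  obtain ⟨l, hl0, hl⟩ : ∃ l : AddChar F ℂ, l ≠ 0 ∧ isoProj τ l ≠ 0 := by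
    by_contra! h
    obtain ⟨s, hs⟩ := hτ
    have h1 := sum_isoProj τ
    rw [Finset.sum_eq_single 0 (fun l _ h0 => h l h0) (by simp)] at h1
    have h2 := mul_isoProj τ 0 s.toAdd
    rw [h1] at h2
    simp at h2
    exact hs h2
  let f : F → AddChar F ℂ := fun a => l.mulShift (a ^ 2)⁻¹
  let S : Finset F := {a : F | a ≠ 0}
  have hf (a : F) (ha : a ≠ 0) : isoProj τ (f a) ≠ 0 := by
    have h := isoProj_conj τ (l := l) (m := f a) (Equiv.mulLeft₀ (a ^ 2) (pow_ne_zero 2 ha))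
      (hX a ha) (fun s => by simp [f, AddChar.mulShift_apply, ha])
    intro h0
    rw [h0] at h
    apply hl
    have hYX : Y a * X a = 1 := mul_eq_one_comm.1 (hXY a ha)
    calc isoProj τ l = (Y a * X a) * isoProj τ l * (Y a * X a) := by rw [hYX]; simp
      _ = Y a * (X a * isoProj τ l * Y a) * X a := by simp only [mul_assoc]
      _ = 0 := by rw [h]; simp
  have hprim : l.IsPrimitive := AddChar.IsPrimitive.of_ne_one hl0
  have hinj (a b : F) (h : f a = f b) : a ^ 2 = b ^ 2 :=
    inv_injective (AddChar.to_mulShift_inj_of_isPrimitive hprim h)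
  have hcard : S.card ≤ 2 * (S.image f).card := by
    refine Finset.card_le_mul_card_image S 2 fun m hm => ?_
    obtain ⟨b, -, rfl⟩ := Finset.mem_image.1 hm
    refine (Finset.card_le_card (t := {b, -b}) fun a ha => ?_).trans Finset.card_le_two
    have := hinj a b (Finset.mem_filter.1 ha).2
    simpa using sq_eq_sq_iff_eq_or_eq_neg.1 this
  have hS : S.card = Fintype.card F - 1 := by
    simp [S, Finset.filter_ne', Finset.card_erase_of_mem]
  have hsum : ((S.image f).card : ℝ) ≤ Fintype.card ι := by
    have h1 := congrArg (fun M => (trace M).re) (sum_isoProj τ)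
    simp only [trace_sum, trace_one, Complex.re_sum, Complex.natCast_re] at h1
    rw [← h1, Finset.card_eq_sum_ones, Nat.cast_sum]
    refine (Finset.sum_le_sum fun m hm => ?_).trans (Finset.sum_le_sum_of_subset_of_nonneg
      (Finset.subset_univ (S.image f))
      fun m _ _ => trace_re_nonneg_of_isIdempotentElem (isoProj_mul_self τ m))
    obtain ⟨b, hb, rfl⟩ := Finset.mem_image.1 hm
    rw [Nat.cast_one]
    exact one_le_trace_re_of_isIdempotentElem (isoProj_mul_self τ _)
      (hf b (Finset.mem_filter.1 hb).2)
  have h1 : (1 : ℕ) ≤ Fintype.card F := Fintype.card_pos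
  have h2 : (S.card : ℝ) ≤ 2 * (S.image f).card := by exact_mod_cast hcard
  rw [hS, Nat.cast_sub h1, Nat.cast_one] at h2
  linarith

end Scaling

section Normalizing

variable {K A : Type*} [Group K] [AddCommGroup A] [Fintype A]
  {κ : K →* Matrix ι ι ℂ} {τ : Multiplicative A →* Matrix ι ι ℂ} (φ : K → A ≃+ A)
  (hφ : ∀ k a, κ k * τ (.ofAdd a) * κ k⁻¹ = τ (.ofAdd (φ k a)))

include hφ

theorem mul_isoProj_eq_isoProj_mul (k : K) (l : AddChar A ℂ) :
    κ k * isoProj τ l =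
      isoProj τ (l.compAddMonoidHom (φ k).symm.toAddMonoidHom) * κ k := by
  have h := isoProj_conj τ (l := l) (m := l.compAddMonoidHom (φ k).symm.toAddMonoidHom)
    (φ k).toEquiv (hφ k) (fun a => by simp [AddChar.compAddMonoidHom_apply])
  rw [← h, mul_assoc, ← map_mul, inv_mul_cancel, map_one, mul_one]

variable [Fintype K]

theorem avgMatrix_commute : Commute (avgMatrix κ) (avgMatrix τ) := by
  have h (k : K) : κ k * avgMatrix τ = avgMatrix τ * κ k := by
    have := mul_isoProj_eq_isoProj_mul φ hφ k 0
    rwa [show (0 : AddChar A ℂ).compAddMonoidHom (φ k).symm.toAddMonoidHom = 0 by ext; simp,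
      isoProj, twist_zero] at this
  rw [Commute, SemiconjBy]
  nth_rw 1 [avgMatrix]
  nth_rw 3 [avgMatrix]
  rw [smul_mul_assoc, mul_smul_comm, Finset.sum_mul, Finset.mul_sum]
  simp_rw [h]

theorem avgMatrix_mul_avgMatrix_mul_self :
    avgMatrix κ * avgMatrix τ * (avgMatrix κ * avgMatrix τ) = avgMatrix κ * avgMatrix τ := by
  rw [(avgMatrix_commute φ hφ).symm.mul_mul_mul_comm, avgMatrix_mul_self, avgMatrix_mul_self]

theorem trace_avgMatrix_le (hκ : ∀ k, (κ k)ᴴ = κ k⁻¹) (hτ : ∀ a, (τ a)ᴴ = τ a⁻¹) {M : ℕ}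
    (hM : 0 < M)
    (hstab : ∀ l : AddChar A ℂ, l ≠ 0 → Nat.card {k | ∀ a, l (φ k a) = l a} * M ≤ Fintype.card K) :
    (avgMatrix κ).trace.re ≤ (avgMatrix κ * avgMatrix τ).trace.re + Fintype.card ι / M := by
  classical
  have hc : (0 : ℝ) < Fintype.card K := by exact_mod_cast Fintype.card_pos
  have hM' : (0 : ℝ) < M := by exact_mod_cast hM
  have hbound (l : AddChar A ℂ) (hl : l ≠ 0) :
      (avgMatrix κ * isoProj τ l).trace.re ≤ (isoProj τ l).trace.re / M := by
    have h0 := trace_re_nonneg_of_isIdempotentElem (isoProj_mul_self τ l)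
    have hzero (k : K) (hk : ¬ ∀ a, l (φ k a) = l a) : (κ k * isoProj τ l).trace = 0 := by
      have hne : l ≠ l.compAddMonoidHom (φ k).symm.toAddMonoidHom := by
        intro h
        refine hk fun a => ?_
        nth_rw 1 [h]
        simp [AddChar.compAddMonoidHom_apply]
      rw [← isoProj_mul_self, ← mul_assoc, trace_mul_comm,
        mul_isoProj_eq_isoProj_mul φ hφ, ← mul_assoc, isoProj_mul_isoProj_of_ne τ hne, zero_mul,
        trace_zero]
    have hle (k : K) : (κ k * isoProj τ l).trace.re ≤ (isoProj τ l).trace.re := by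
      have h := norm_trace_conjTranspose_mul_sq_le (isoProj τ l) (κ k * isoProj τ l)
      rw [conjTranspose_mul, hκ, conjTranspose_isoProj hτ, isoProj_mul_self,
        show isoProj τ l * κ k⁻¹ * (κ k * isoProj τ l) =
          isoProj τ l * (κ k⁻¹ * κ k) * isoProj τ l by simp only [mul_assoc],
        ← map_mul, inv_mul_cancel, map_one, mul_one, isoProj_mul_self, trace_mul_comm, mul_assoc,
        isoProj_mul_self, ← sq] at h
      exact (Complex.re_le_norm _).trans (le_of_sq_le_sq h h0)
    rw [avgMatrix, smul_mul_assoc, Finset.sum_mul, trace_smul, trace_sum, smul_eq_mul,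
      ← Complex.ofReal_natCast, ← Complex.ofReal_inv, Complex.re_ofReal_mul, Complex.re_sum]
    have hs : ∑ k, (κ k * isoProj τ l).trace.re ≤
        (Nat.card {k | ∀ a, l (φ k a) = l a}) * (isoProj τ l).trace.re := by
      rw [← Finset.sum_filter_of_ne (p := fun k => ∀ a, l (φ k a) = l a)
        (fun k _ h => by by_contra h'; exact h (by rw [hzero k h', Complex.zero_re]))]
      refine (Finset.sum_le_card_nsmul _ _ _ fun k _ => hle k).trans (le_of_eq ?_)
      rw [nsmul_eq_mul, Nat.card_eq_fintype_card, Fintype.card_subtype]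
      simp only [Set.mem_ofPred_eq]
    rw [inv_mul_le_iff₀ hc]
    refine hs.trans ?_
    have := hstab l hl
    have h2 : (Nat.card {k | ∀ a, l (φ k a) = l a} : ℝ) * M ≤ Fintype.card K := by
      exact_mod_cast this
    rw [mul_div_assoc', le_div_iff₀ hM']
    nlinarith
  have hsum : (avgMatrix κ).trace.re = ∑ l, (avgMatrix κ * isoProj τ l).trace.re := by
    rw [← Complex.re_sum, ← trace_sum, ← Finset.mul_sum, sum_isoProj, mul_one]
  have htot : ∑ l, (isoProj τ l).trace.re = Fintype.card ι := by
    rw [← Complex.re_sum, ← trace_sum, sum_isoProj, trace_one, Complex.natCast_re]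
  rw [hsum, ← Finset.add_sum_erase _ _ (Finset.mem_univ 0), isoProj, twist_zero]
  gcongr
  rw [← htot, Finset.sum_div]
  refine (Finset.sum_le_sum fun l hl => hbound l (Finset.ne_of_mem_erase hl)).trans ?_
  exact Finset.sum_le_sum_of_subset_of_nonneg (Finset.subset_univ _) fun l _ _ =>
    div_nonneg (trace_re_nonneg_of_isIdempotentElem (isoProj_mul_self τ l)) hM'.le

end Normalizing
end UnitaryRepresentations

section

open scoped ComplexOrder MatrixOrder in
theorem Matrix.PosDef.exists_eq_conjTranspose_mul_self {ι : Type*} [Fintype ι] [DecidableEq ι]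
    {P : Matrix ι ι ℂ} (hP : P.PosDef) : ∃ S : Matrix ι ι ℂ, P = Sᴴ * S ∧ IsUnit S := by
  have h0 : 0 ≤ P := hP.posSemidef.nonneg
  have h1 : CFC.sqrt P * CFC.sqrt P = P := CFC.sqrt_mul_sqrt_self P h0
  refine ⟨CFC.sqrt P, ?_, ?_⟩
  · have h2 : (CFC.sqrt P)ᴴ = CFC.sqrt P := (CFC.sqrt_nonneg P).posSemidef.isHermitian
    rw [h2, h1]
  · have := hP.isUnit
    rw [← h1] at this
    exact isUnit_of_mul_isUnit_left this

open scoped ComplexOrder in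
theorem exists_unitary_hom {G : Type} [Group G] [Finite G] (V : FDRep ℂ G) :
    ∃ (d : ℕ) (σ : G →* Matrix (Fin d) (Fin d) ℂ),
      (∀ g, (σ g)ᴴ = σ g⁻¹) ∧ ∀ g, (σ g).trace = V.character g := by
  classical
  have := Fintype.ofFinite G
  let b := Module.finBasis ℂ V
  let m : G →* Matrix (Fin (Module.finrank ℂ V)) (Fin (Module.finrank ℂ V)) ℂ :=
    (LinearMap.toMatrixAlgEquiv b : _ →* _).comp V.ρ
  have hinv (g : G) : m g * m g⁻¹ = 1 := by rw [← map_mul, mul_inv_cancel, map_one]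
  set P := ∑ h, (m h)ᴴ * m h with hP
  have hPos : P.PosDef := by
    rw [hP]
    refine posDef_sum Finset.univ_nonempty fun h _ => ?_
    refine PosDef.conjTranspose_mul_self _ ?_
    rw [mulVec_injective_iff_isUnit]
    exact IsUnit.of_mul_eq_one _ (hinv h)
  have hinvar (g : G) : (m g)ᴴ * P * m g = P := by
    rw [hP, Finset.mul_sum, Finset.sum_mul]
    refine Fintype.sum_equiv (Equiv.mulRight g) _ _ fun h => ?_
    rw [Equiv.coe_mulRight, map_mul, conjTranspose_mul]
    simp only [mul_assoc]
  obtain ⟨S, hS, hSu⟩ := hPos.exists_eq_conjTranspose_mul_self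
  rw [isUnit_iff_isUnit_det] at hSu
  have hSS : S * S⁻¹ = 1 := mul_nonsing_inv S hSu
  have hSS' : S⁻¹ * S = 1 := nonsing_inv_mul S hSu
  refine ⟨_, { toFun := fun g => S * m g * S⁻¹, map_one' := ?_, map_mul' := ?_ }, ?_, ?_⟩
  · rw [map_one, mul_one, hSS]
  · intro g h
    calc S * m (g * h) * S⁻¹ = S * m g * 1 * m h * S⁻¹ := by
          rw [map_mul]; simp only [mul_assoc, mul_one]
      _ = S * m g * (S⁻¹ * S) * m h * S⁻¹ := by rw [hSS']
      _ = _ := by simp only [mul_assoc]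
  · intro g
    have h2 : Sᴴ * S * m g⁻¹ = (m g)ᴴ * (Sᴴ * S) := by
      rw [← hS]
      nth_rw 1 [← hinvar g]
      rw [mul_assoc, hinv, mul_one]
    have h3 : (S⁻¹)ᴴ * Sᴴ = 1 := by rw [← conjTranspose_mul, hSS, conjTranspose_one]
    change (S * m g * S⁻¹)ᴴ = S * m g⁻¹ * S⁻¹
    rw [conjTranspose_mul, conjTranspose_mul]
    calc (S⁻¹)ᴴ * ((m g)ᴴ * Sᴴ) = (S⁻¹)ᴴ * ((m g)ᴴ * (Sᴴ * S)) * S⁻¹ := by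
          simp only [mul_assoc, hSS, mul_one]
      _ = ((S⁻¹)ᴴ * Sᴴ) * S * m g⁻¹ * S⁻¹ := by rw [← h2]; simp only [mul_assoc]
      _ = _ := by rw [h3, one_mul]
  · intro g
    change (S * m g * S⁻¹).trace = _
    rw [trace_mul_cycle, hSS', one_mul]
    exact LinearMap.trace_eq_matrix_trace ℂ b _ |>.symm

section Irreducible

variable {ι : Type*} [Fintype ι] [DecidableEq ι] {G : Type*} [Group G] [Fintype G]
  {σ : G →* Matrix ι ι ℂ}

/-- A representation whose character has norm one fixes no nonzero vector, unless the character is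
trivial. -/
theorem eq_zero_of_forall_mulVec_eq (hnorm : ∑ g, ‖(σ g).trace‖ ^ 2 = Fintype.card G)
    (hne : ∃ g, (σ g).trace ≠ 1) {v : ι → ℂ} (hv : ∀ g, σ g *ᵥ v = v) : v = 0 := by
  by_contra hv0
  have hc : (0 : ℝ) < Fintype.card G := by exact_mod_cast Fintype.card_pos
  have hP := avgMatrix_mul_self σ
  have hP0 : avgMatrix σ ≠ 0 := by
    intro h
    have := avgMatrix_mul_of_forall hv
    rw [h, zero_mulVec] at this
    exact hv0 this.symm
  have h1 := one_le_trace_re_of_isIdempotentElem hP hP0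
  have h2 := trace_eq_finrank_range_of_isIdempotentElem hP
  set k := Module.finrank ℂ (LinearMap.range (toLin' (avgMatrix σ))) with hk
  rw [h2, Complex.natCast_re] at h1
  have h3 : ∑ g, (σ g).trace = Fintype.card G * (k : ℂ) := by
    rw [← h2, trace_avgMatrix, mul_inv_cancel_left₀]
    exact_mod_cast hc.ne'
  have h4 : ∑ g, ‖(σ g).trace - k‖ ^ 2 = Fintype.card G * (1 - (k : ℝ) ^ 2) := by
    have (g : G) : ‖(σ g).trace - k‖ ^ 2 =
        ‖(σ g).trace‖ ^ 2 - 2 * k * (σ g).trace.re + (k : ℝ) ^ 2 := by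
      rw [← Complex.normSq_eq_norm_sq, ← Complex.normSq_eq_norm_sq, Complex.normSq_apply,
        Complex.normSq_apply]
      simp
      ring
    simp_rw [this]
    rw [Finset.sum_add_distrib, Finset.sum_sub_distrib, hnorm, ← Finset.mul_sum, ← Complex.re_sum,
      h3]
    simp
    ring
  have h5 : ∑ g, ‖(σ g).trace - k‖ ^ 2 = 0 := by
    refine le_antisymm ?_ (Finset.sum_nonneg fun g _ => by positivity)
    rw [h4]
    exact mul_nonpos_of_nonneg_of_nonpos hc.le (by nlinarith)
  have h6 : (k : ℝ) = 1 := by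
    rw [h4] at h5
    have := (mul_eq_zero.1 h5).resolve_left hc.ne'
    nlinarith
  obtain ⟨g, hg⟩ := hne
  apply hg
  have := (Finset.sum_eq_zero_iff_of_nonneg fun g _ => by positivity).1 h5 g (Finset.mem_univ g)
  rw [sq_eq_zero_iff, norm_eq_zero, sub_eq_zero] at this
  rw [this]
  exact_mod_cast h6

theorem card_pos_of_sum_norm_sq (hnorm : ∑ g, ‖(σ g).trace‖ ^ 2 = Fintype.card G) :
    0 < Fintype.card ι := by
  by_contra! h
  have : IsEmpty ι := Fintype.card_eq_zero_iff.1 (by omega)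
  have hc : (0 : ℝ) < Fintype.card G := by exact_mod_cast Fintype.card_pos
  simp [trace] at hnorm
  linarith

theorem exists_ne_one_of_trace_ne_one (hnorm : ∑ g, ‖(σ g).trace‖ ^ 2 = Fintype.card G)
    (hne : ∃ g, (σ g).trace ≠ 1) : ∃ g, σ g ≠ 1 := by
  by_contra! h
  obtain ⟨i⟩ : Nonempty ι := Fintype.card_pos_iff.1 (card_pos_of_sum_norm_sq hnorm)
  have := congrFun (eq_zero_of_forall_mulVec_eq hnorm hne (v := Pi.single i 1)
    fun g => by rw [h, one_mulVec]) i
  simp at this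

end Irreducible

section TwoAbelian

variable {ι : Type*} [Fintype ι] [DecidableEq ι] {G : Type*} [Group G]
  {σ : G →* Matrix ι ι ℂ}

theorem forall_mulVec_eq_of_closure {s : Set G} (hs : Subgroup.closure s = ⊤) {v : ι → ℂ}
    (hv : ∀ g ∈ s, σ g *ᵥ v = v) (g : G) : σ g *ᵥ v = v := by
  have hg : g ∈ Subgroup.closure s := hs ▸ Subgroup.mem_top g
  induction hg using Subgroup.closure_induction with
  | mem x hx => exact hv x hx
  | one => simp
  | mul x y _ _ hx hy => rw [map_mul, ← mulVec_mulVec, hy, hx]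
  | inv x _ hx =>
    nth_rw 1 [← hx]
    rw [mulVec_mulVec, ← map_mul, inv_mul_cancel, map_one, one_mulVec]

theorem two_mul_norm_le_of_abelian [Fintype G] (hσ : ∀ g, (σ g)ᴴ = σ g⁻¹)
    (hnorm : ∑ g, ‖(σ g).trace‖ ^ 2 = Fintype.card G) (hne : ∃ g, (σ g).trace ≠ 1)
    {A : Type*} [AddCommGroup A] [Fintype A] (hA : 3 ≤ Fintype.card A)
    (x y : Multiplicative A →* G)
    (hxy : Subgroup.closure (Set.range x ∪ Set.range y) = ⊤) {C : ℂ}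
    (hx : ∀ a ≠ 1, (σ (x a)).trace = C) (hy : ∀ a ≠ 1, (σ (y a)).trace = C) :
    2 * ‖C‖ ≤ Fintype.card ι := by
  classical
  have htr (z : Multiplicative A →* G) (hz : ∀ a ≠ 1, (σ (z a)).trace = C) :
      (avgMatrix (σ.comp z)).trace.re * Fintype.card A =
        Fintype.card ι + (Fintype.card A - 1) * C.re := by
    have hc : (Fintype.card A : ℂ) ≠ 0 := Nat.cast_ne_zero.2 Fintype.card_ne_zero
    have h : (avgMatrix (σ.comp z)).trace * Fintype.card A =
        Fintype.card ι + (Fintype.card A - 1) * C := by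
      rw [trace_avgMatrix, Fintype.card_multiplicative, mul_comm, mul_inv_cancel_left₀ hc,
        ← Finset.add_sum_erase _ _ (Finset.mem_univ 1)]
      simp_rw [MonoidHom.comp_apply]
      rw [Finset.sum_congr rfl fun a ha => hz a (Finset.ne_of_mem_erase ha)]
      simp [Finset.card_erase_of_mem, Nat.cast_sub Fintype.card_pos]
    have h' := congrArg Complex.re h
    rw [mul_comm, ← Complex.ofReal_natCast, Complex.re_ofReal_mul] at h'
    rw [mul_comm, h']
    simp
  have h1 := trace_add_trace_le (avgMatrix_mul_self (σ.comp x)) (avgMatrix_mul_self (σ.comp y))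
    (one_mul (1 : Matrix ι ι ℂ)) (one_mul _) (one_mul _) ⊥ (fun v hv hv' => by
      rw [avgMatrix_mulVec_eq_iff] at hv hv'
      refine eq_zero_of_forall_mulVec_eq hnorm hne (forall_mulVec_eq_of_closure hxy ?_)
      rintro g (⟨a, rfl⟩ | ⟨a, rfl⟩)
      exacts [hv a, hv' a])
  have h2 := trace_re_nonneg_of_isIdempotentElem (avgMatrix_mul_self (σ.comp x))
  rw [trace_one, Complex.natCast_re, finrank_bot] at h1
  have hxx := htr x hx
  have hyy := htr y hy
  have hA' : (3 : ℝ) ≤ Fintype.card A := by exact_mod_cast hA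
  have hd : (0 : ℝ) ≤ Fintype.card ι := Nat.cast_nonneg _
  have him : C.im = 0 := by
    have : Nontrivial A := Fintype.one_lt_card_iff_nontrivial.1 (by omega)
    obtain ⟨a, ha⟩ := exists_ne (1 : Multiplicative A)
    have h := trace_inv_eq hσ (x a)
    rw [← map_inv, hx a ha, hx _ (inv_ne_one.2 ha)] at h
    exact Complex.conj_eq_iff_im.1 h.symm
  have hC : ‖C‖ = |C.re| := by
    rw [Complex.norm_def, Complex.normSq_apply, him, mul_zero, add_zero, Real.sqrt_mul_self_eq_abs]
  rw [hC]
  set N : ℝ := (Fintype.card A : ℝ)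
  have h3 : 2 * (Fintype.card ι + (N - 1) * C.re) ≤ Fintype.card ι * N := by
    have := mul_le_mul_of_nonneg_right h1 (by linarith : 0 ≤ N)
    rw [add_mul, hxx, hyy] at this
    simp at this
    linarith
  have h4 : 0 ≤ Fintype.card ι + (N - 1) * C.re := by
    rw [← hxx]; positivity
  rw [← abs_two, ← abs_mul, abs_le]
  constructor
  · by_contra! h
    nlinarith
  · by_contra! h
    nlinarith

end TwoAbelian

section Conjugation

variable {ι : Type*} [Fintype ι] [DecidableEq ι] {G : Type*} [Group G]
  {σ : G →* Matrix ι ι ℂ}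

open scoped Kronecker

/-- The tensor product of a matrix representation with its complex conjugate. -/
noncomputable def adjointHom (σ : G →* Matrix ι ι ℂ) : G →* Matrix (ι × ι) (ι × ι) ℂ where
  toFun g := σ g ⊗ₖ (σ g).map (starRingEnd ℂ)
  map_one' := by simp [Matrix.map_one]
  map_mul' g h := by
    rw [map_mul, Matrix.map_mul, mul_kronecker_mul]

theorem trace_adjointHom (g : G) : (adjointHom σ g).trace = (‖(σ g).trace‖ ^ 2 : ℝ) := by
  change (σ g ⊗ₖ (σ g).map (starRingEnd ℂ)).trace = _
  rw [trace_kronecker, ← AddMonoidHom.map_trace, Complex.ofReal_pow]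
  exact Complex.mul_conj' _

theorem conjTranspose_adjointHom (hσ : ∀ g, (σ g)ᴴ = σ g⁻¹) (g : G) :
    (adjointHom σ g)ᴴ = adjointHom σ g⁻¹ := by
  change (σ g ⊗ₖ (σ g).map (starRingEnd ℂ))ᴴ = σ g⁻¹ ⊗ₖ (σ g⁻¹).map (starRingEnd ℂ)
  rw [conjTranspose_kronecker, ← hσ]
  rfl

theorem trace_avgMatrix_adjointHom_re {K : Type*} [Group K] [Fintype K] (κ : K →* G) :
    (avgMatrix ((adjointHom σ).comp κ)).trace.re =
      (Fintype.card K : ℝ)⁻¹ * ∑ k, ‖(σ (κ k)).trace‖ ^ 2 := by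
  rw [trace_avgMatrix]
  simp only [MonoidHom.comp_apply, trace_adjointHom]
  rw [← Complex.ofReal_sum, ← Complex.ofReal_natCast, ← Complex.ofReal_inv, ← Complex.ofReal_mul,
    Complex.ofReal_re]

theorem average_norm_sq_le [Fintype G] (hσ : ∀ g, (σ g)ᴴ = σ g⁻¹)
    (hnorm : ∑ g, ‖(σ g).trace‖ ^ 2 = Fintype.card G)
    {K A B : Type*} [Group K] [Fintype K] [AddCommGroup A] [Fintype A] [AddCommGroup B] [Fintype B]
    (κ : K →* G) (x : Multiplicative A →* G) (y : Multiplicative B →* G)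
    (φ : K → A ≃+ A) (hφ : ∀ k a, κ k * x (.ofAdd a) * κ k⁻¹ = x (.ofAdd (φ k a)))
    (φ' : K → B ≃+ B) (hφ' : ∀ k a, κ k * y (.ofAdd a) * κ k⁻¹ = y (.ofAdd (φ' k a)))
    {M : ℕ} (hM : 0 < M)
    (hstab : ∀ l : AddChar A ℂ, l ≠ 0 → Nat.card {k | ∀ a, l (φ k a) = l a} * M ≤ Fintype.card K)
    (hstab' : ∀ l : AddChar B ℂ, l ≠ 0 →
      Nat.card {k | ∀ a, l (φ' k a) = l a} * M ≤ Fintype.card K)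
    (hgen : Subgroup.closure (Set.range κ ∪ Set.range x ∪ Set.range y) = ⊤) :
    (Fintype.card K : ℝ)⁻¹ * ∑ k, ‖(σ (κ k)).trace‖ ^ 2 ≤
      1 + 2 * (Fintype.card ι : ℝ) ^ 2 / M := by
  set w := adjointHom σ with hw
  have hwu := conjTranspose_adjointHom hσ
  have hc : (Fintype.card G : ℝ) ≠ 0 := Nat.cast_ne_zero.2 Fintype.card_ne_zero
  have h1 := trace_avgMatrix_le (κ := w.comp κ) (τ := w.comp x) φ
    (fun k a => by simp only [MonoidHom.comp_apply, ← map_mul, hφ])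
    (fun k => by rw [MonoidHom.comp_apply, hwu, ← map_inv]; rfl)
    (fun k => by rw [MonoidHom.comp_apply, hwu, ← map_inv]; rfl) hM hstab
  have h2 := trace_avgMatrix_le (κ := w.comp κ) (τ := w.comp y) φ'
    (fun k a => by simp only [MonoidHom.comp_apply, ← map_mul, hφ'])
    (fun k => by rw [MonoidHom.comp_apply, hwu, ← map_inv]; rfl)
    (fun k => by rw [MonoidHom.comp_apply, hwu, ← map_inv]; rfl) hM hstab'
  have hcx : Commute (avgMatrix (w.comp κ)) (avgMatrix (w.comp x)) := avgMatrix_commute φ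
    (fun k a => by simp only [MonoidHom.comp_apply, ← map_mul, hφ])
  have hcy : Commute (avgMatrix (w.comp κ)) (avgMatrix (w.comp y)) := avgMatrix_commute φ'
    (fun k a => by simp only [MonoidHom.comp_apply, ← map_mul, hφ'])
  have hfin : (Module.finrank ℂ (LinearMap.range (toLin' (avgMatrix w))) : ℝ) = 1 := by
    have h3 := trace_avgMatrix_adjointHom_re (σ := σ) (MonoidHom.id G)
    rw [MonoidHom.comp_id, trace_eq_finrank_range_of_isIdempotentElem (avgMatrix_mul_self _),
      Complex.natCast_re] at h3
    rw [h3]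
    simp [hnorm, hc]
  have h3 := trace_add_trace_le
    (avgMatrix_mul_avgMatrix_mul_self (κ := w.comp κ) (τ := w.comp x) φ
      (fun k a => by simp only [MonoidHom.comp_apply, ← map_mul, hφ]))
    (avgMatrix_mul_avgMatrix_mul_self (κ := w.comp κ) (τ := w.comp y) φ'
      (fun k a => by simp only [MonoidHom.comp_apply, ← map_mul, hφ']))
    (avgMatrix_mul_self (w.comp κ)) (by rw [← mul_assoc, avgMatrix_mul_self])
    (by rw [← mul_assoc, avgMatrix_mul_self]) (LinearMap.range (toLin' (avgMatrix w)))
    (fun v hv hv' => by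
      have e1 : avgMatrix (w.comp κ) *ᵥ v = v := by
        rw [← hv, mulVec_mulVec, ← mul_assoc, avgMatrix_mul_self]
      have e2 : avgMatrix (w.comp x) *ᵥ v = v := by
        rw [← hv, mulVec_mulVec, hcx.eq, ← mul_assoc, avgMatrix_mul_self]
      have e3 : avgMatrix (w.comp y) *ᵥ v = v := by
        rw [← hv', mulVec_mulVec, hcy.eq, ← mul_assoc, avgMatrix_mul_self]
      rw [avgMatrix_mulVec_eq_iff] at e1 e2 e3
      rw [mem_range_toLin'_iff (avgMatrix_mul_self _), avgMatrix_mulVec_eq_iff]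
      refine forall_mulVec_eq_of_closure hgen ?_
      rintro g ((⟨a, rfl⟩ | ⟨a, rfl⟩) | ⟨a, rfl⟩)
      exacts [e1 a, e2 a, e3 a])
  rw [hfin] at h3
  rw [← trace_avgMatrix_adjointHom_re]
  rw [Fintype.card_prod] at h1 h2
  have : 2 * (Fintype.card ι : ℝ) ^ 2 / M = ((Fintype.card ι * Fintype.card ι : ℕ) : ℝ) / M +
      ((Fintype.card ι * Fintype.card ι : ℕ) : ℝ) / M := by push_cast; ring
  rw [this]
  linarith

end Conjugation

end

section Characters

theorem IsIrrChar.exists_unitary_hom {G : Type} [Group G] [Fintype G] {χ : G → ℂ}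
    (h : IsIrrChar G χ) : ∃ (d : ℕ) (σ : G →* Matrix (Fin d) (Fin d) ℂ),
      (∀ g, (σ g)ᴴ = σ g⁻¹) ∧ (∀ g, (σ g).trace = χ g) ∧
        ∑ g, ‖(σ g).trace‖ ^ 2 = Fintype.card G := by
  obtain ⟨V, hV, hχ⟩ := h
  obtain ⟨d, σ, hσ, htr⟩ := _root_.exists_unitary_hom V
  refine ⟨d, σ, hσ, fun g => (htr g).trans (hχ g), ?_⟩
  have h1 := (FDRep.simple_iff_char_is_norm_one V).1 hV
  simp_rw [← htr, trace_inv_eq hσ, Complex.mul_conj'] at h1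
  rw [Nat.card_eq_fintype_card] at h1
  exact_mod_cast h1

theorem IsIrrChar.sum_norm_sq {G : Type} [Group G] [Fintype G] {χ : G → ℂ}
    (h : IsIrrChar G χ) : ∑ g, ‖χ g‖ ^ 2 = Fintype.card G := by
  obtain ⟨d, σ, -, htr, hn⟩ := h.exists_unitary_hom
  simpa [htr] using hn

theorem IsIrrChar.exists_apply_one_eq {G : Type} [Group G] [Fintype G] {χ : G → ℂ}
    (h : IsIrrChar G χ) : ∃ d : ℕ, 0 < d ∧ χ 1 = d := by
  obtain ⟨d, σ, -, htr, hn⟩ := h.exists_unitary_hom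
  exact ⟨d, by simpa using card_pos_of_sum_norm_sq hn, by simp [← htr]⟩

theorem sum_comp_of_surjective {G H : Type*} [Group G] [Group H] [Fintype G] [Fintype H]
    (π : G →* H) (hπ : Function.Surjective π) (f : H → ℝ) :
    (Fintype.card H : ℝ) * ∑ g, f (π g) = Fintype.card G * ∑ h, f h := by
  classical
  set c := (Finset.univ.filter fun g => π g = 1).card with hc
  have hfib (h : H) : (Finset.univ.filter fun g => π g = h).card = c :=
    MonoidHom.card_fiber_eq_of_mem_range π (hπ h) (hπ 1)
  have h1 (f : H → ℝ) : ∑ g, f (π g) = c * ∑ h, f h := by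
    rw [← Finset.sum_fiberwise Finset.univ π, Finset.mul_sum]
    refine Finset.sum_congr rfl fun h _ => ?_
    rw [Finset.sum_congr rfl fun g hg => by rw [(Finset.mem_filter.1 hg).2], Finset.sum_const,
      hfib, nsmul_eq_mul]
  have h2 : (Fintype.card G : ℝ) = c * Fintype.card H := by
    simpa using h1 fun _ => 1
  rw [h1, h2]
  ring

theorem charInner_eq_sum {G : Type} [Group G] [Fintype G] (φ ψ : G → ℂ) :
    charInner φ ψ = (Fintype.card G : ℂ)⁻¹ * ∑ g, φ g * (starRingEnd ℂ) (ψ g) := by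
  rw [charInner, finsum_eq_sum_of_fintype, Nat.card_eq_fintype_card]

theorem charInner_pow_mul_ne_zero {G : Type} [Group G] [Fintype G] {α χ₁ χ₂ : G → ℂ}
    (hα : α 1 ≠ 0) (h₁ : IsIrrChar G χ₁) (h₂ : IsIrrChar G χ₂) {ε : ℝ}
    (hε : ∀ g ≠ 1, ‖α g‖ ≤ ε * ‖α 1‖) (hε0 : 0 ≤ ε) {j : ℕ}
    (hj : ε ^ j * Fintype.card G < 1) : charInner (α ^ j * χ₁) χ₂ ≠ 0 := by
  classical
  have hc : (Fintype.card G : ℂ) ≠ 0 := Nat.cast_ne_zero.2 Fintype.card_ne_zero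
  obtain ⟨d₁, hd₁, hχ₁⟩ := h₁.exists_apply_one_eq
  obtain ⟨d₂, hd₂, hχ₂⟩ := h₂.exists_apply_one_eq
  have hcs : ∑ g, ‖χ₁ g‖ * ‖χ₂ g‖ ≤ Fintype.card G := by
    have h := Finset.sum_mul_sq_le_sq_mul_sq Finset.univ (fun g => ‖χ₁ g‖) (fun g => ‖χ₂ g‖)
    rw [h₁.sum_norm_sq, h₂.sum_norm_sq, ← sq] at h
    exact le_of_sq_le_sq h (by positivity)
  rw [charInner_eq_sum]
  refine mul_ne_zero (inv_ne_zero hc) ?_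
  rw [← Finset.add_sum_erase _ _ (Finset.mem_univ 1)]
  intro h0
  have hpos : 0 < ‖α 1‖ ^ j := pow_pos (norm_pos_iff.2 hα) j
  have h1 : ‖α 1‖ ^ j ≤ ‖(α ^ j * χ₁) 1 * (starRingEnd ℂ) (χ₂ 1)‖ := by
    rw [Pi.mul_apply, Pi.pow_apply, hχ₁, hχ₂, norm_mul, norm_mul, norm_pow, RCLike.norm_conj,
      Complex.norm_natCast, Complex.norm_natCast, mul_assoc]
    refine le_mul_of_one_le_right hpos.le ?_
    exact_mod_cast Nat.mul_pos hd₁ hd₂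
  have h2 : ‖∑ g ∈ Finset.univ.erase (1 : G), (α ^ j * χ₁) g * (starRingEnd ℂ) (χ₂ g)‖ ≤
      ‖α 1‖ ^ j * (ε ^ j * Fintype.card G) := by
    refine (norm_sum_le _ _).trans ?_
    have (g) (hg : g ∈ Finset.univ.erase (1 : G)) :
        ‖(α ^ j * χ₁) g * (starRingEnd ℂ) (χ₂ g)‖ ≤ (ε * ‖α 1‖) ^ j * (‖χ₁ g‖ * ‖χ₂ g‖) := by
      rw [Pi.mul_apply, Pi.pow_apply, norm_mul, norm_mul, norm_pow, RCLike.norm_conj, mul_assoc]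
      gcongr
      exact hε g (Finset.ne_of_mem_erase hg)
    refine (Finset.sum_le_sum this).trans ?_
    rw [← Finset.mul_sum, mul_pow, mul_comm (ε ^ j), mul_assoc]
    gcongr
    exact (Finset.sum_le_sum_of_subset_of_nonneg (Finset.subset_univ _)
      fun _ _ _ => by positivity).trans hcs
  rw [eq_neg_of_add_eq_zero_left h0, norm_neg] at h1
  nlinarith

theorem exists_charInner_pow_mul_ne_zero {G : Type} [Group G] [Fintype G] {α χ₁ χ₂ : G → ℂ}
    (h₁ : IsIrrChar G χ₁) (h₂ : IsIrrChar G χ₂) (s : Finset ℂ)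
    (hs : ∀ g ≠ 1, α g ∈ s) (hs1 : α 1 ∉ s) :
    ∃ j ≤ s.card, charInner (α ^ j * χ₁) χ₂ ≠ 0 := by
  classical
  have hc : (Fintype.card G : ℂ) ≠ 0 := Nat.cast_ne_zero.2 Fintype.card_ne_zero
  obtain ⟨d₁, hd₁, hχ₁⟩ := h₁.exists_apply_one_eq
  obtain ⟨d₂, hd₂, hχ₂⟩ := h₂.exists_apply_one_eq
  let p : Polynomial ℂ := ∏ a ∈ s, (Polynomial.X - Polynomial.C a)
  have hdeg : p.natDegree = s.card := Polynomial.natDegree_finsetProd_X_sub_C_eq_card s _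
  have heval (z : ℂ) : p.eval z = ∏ a ∈ s, (z - a) := by
    simp [p, Polynomial.eval_prod]
  by_contra! h
  have h1 : ∑ j ∈ Finset.range (p.natDegree + 1), p.coeff j * charInner (α ^ j * χ₁) χ₂ = 0 :=
    Finset.sum_eq_zero fun j hj => by
      rw [h j (by rw [← hdeg]; exact Nat.lt_succ_iff.1 (Finset.mem_range.1 hj)), mul_zero]
  have h2 : ∑ j ∈ Finset.range (p.natDegree + 1), p.coeff j * charInner (α ^ j * χ₁) χ₂ =
      (Fintype.card G : ℂ)⁻¹ * ∑ g, p.eval (α g) * (χ₁ g * (starRingEnd ℂ) (χ₂ g)) := by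
    simp_rw [charInner_eq_sum, Polynomial.eval_eq_sum_range, Finset.sum_mul, Finset.mul_sum]
    rw [Finset.sum_comm]
    refine Finset.sum_congr rfl fun g _ => Finset.sum_congr rfl fun j _ => ?_
    rw [Pi.mul_apply, Pi.pow_apply]
    ring
  rw [h1, Finset.sum_eq_single 1] at h2
  · refine (mul_ne_zero (inv_ne_zero hc) (mul_ne_zero ?_ ?_)) h2.symm
    · rw [heval, Finset.prod_ne_zero_iff]
      rintro a ha h
      rw [sub_eq_zero] at h
      exact hs1 (h ▸ ha)
    · rw [hχ₁, hχ₂]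
      simp [hd₁.ne', hd₂.ne']
  · intro g _ hg
    rw [heval, Finset.prod_eq_zero (hs g hg) (sub_self _), zero_mul]
  · simp

end Characters

section Elation

open Matrix.SpecialLinearGroup

variable {ι F : Type*} [Fintype ι] [DecidableEq ι] [Field F]

theorem det_one_add_vecMulVec (v f : ι → F) : (1 + vecMulVec v f).det = 1 + f ⬝ᵥ v := by
  rw [vecMulVec_eq Unit, det_one_add_replicateCol_mul_replicateRow]

/-- The transvection `1 + v f` attached to a vector `v` and a row vector `f` with `f v = 0`. -/
def elation (v f : ι → F) (h : f ⬝ᵥ v = 0) : SpecialLinearGroup ι F :=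
  ⟨1 + vecMulVec v f, by rw [det_one_add_vecMulVec, h, add_zero]⟩

theorem coe_elation {v f : ι → F} (h : f ⬝ᵥ v = 0) :
    (elation v f h : Matrix ι ι F) = 1 + vecMulVec v f := rfl

theorem coe_mul_coe_inv (g : SpecialLinearGroup ι F) :
    (g : Matrix ι ι F) * (g⁻¹ : SpecialLinearGroup ι F) = 1 := by
  rw [← coe_mul, mul_inv_cancel, coe_one]

theorem coe_inv_mul_coe (g : SpecialLinearGroup ι F) :
    ((g⁻¹ : SpecialLinearGroup ι F) : Matrix ι ι F) * g = 1 := by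
  rw [← coe_mul, inv_mul_cancel, coe_one]

theorem vecMul_inv_dotProduct_mulVec (g : SpecialLinearGroup ι F) (v f : ι → F) :
    (f ᵥ* (g⁻¹ : SpecialLinearGroup ι F).1) ⬝ᵥ (g.1 *ᵥ v) = f ⬝ᵥ v := by
  rw [dotProduct_mulVec, vecMul_vecMul, coe_inv_mul_coe, vecMul_one]

theorem conj_elation (g : SpecialLinearGroup ι F) {v f : ι → F} (h : f ⬝ᵥ v = 0) :
    g * elation v f h * g⁻¹ = elation (g.1 *ᵥ v) (f ᵥ* (g⁻¹ : SpecialLinearGroup ι F).1)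
      (by rw [vecMul_inv_dotProduct_mulVec, h]) := by
  apply Subtype.ext
  rw [coe_mul, coe_mul, coe_elation, coe_elation, mul_add, add_mul, mul_one, coe_mul_coe_inv,
    mul_vecMulVec, vecMulVec_mul]

theorem elation_mul_elation_right {v f f' : ι → F} (h : f ⬝ᵥ v = 0) (h' : f' ⬝ᵥ v = 0) :
    elation v f h * elation v f' h' = elation v (f + f')
      (by rw [add_dotProduct, h, h', add_zero]) := by
  apply Subtype.ext
  rw [coe_mul, coe_elation, coe_elation, coe_elation, add_mul, one_mul, mul_add, mul_one,
    vecMulVec_mul_vecMulVec, h, vecMulVec_add]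
  simp [add_assoc, add_comm]

theorem elation_mul_elation_left {v v' f : ι → F} (h : f ⬝ᵥ v = 0) (h' : f ⬝ᵥ v' = 0) :
    elation v f h * elation v' f h' = elation (v + v') f
      (by rw [dotProduct_add, h, h', add_zero]) := by
  apply Subtype.ext
  rw [coe_mul, coe_elation, coe_elation, coe_elation, add_mul, one_mul, mul_add, mul_one,
    vecMulVec_mul_vecMulVec, h', add_vecMulVec]
  simp [add_assoc, add_comm]

theorem elation_eq_one_iff {v f : ι → F} (h : f ⬝ᵥ v = 0) :
    elation v f h = 1 ↔ v = 0 ∨ f = 0 := by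
  rw [← vecMulVec_eq_zero]
  exact Subtype.ext_iff.trans (add_eq_left (a := (1 : Matrix ι ι F)))

/-- The annihilator of a vector with respect to the dot product. -/
def orth (v : ι → F) : Submodule F (ι → F) where
  carrier := {f | f ⬝ᵥ v = 0}
  add_mem' {a b} (ha : a ⬝ᵥ v = 0) (hb : b ⬝ᵥ v = 0) := by
    change (a + b) ⬝ᵥ v = 0
    rw [add_dotProduct, ha, hb, add_zero]
  zero_mem' := zero_dotProduct v
  smul_mem' c f (hf : f ⬝ᵥ v = 0) := by
    change (c • f) ⬝ᵥ v = 0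
    rw [smul_dotProduct, hf, smul_zero]

omit [DecidableEq ι] in
theorem mem_orth {v f : ι → F} : f ∈ orth v ↔ f ⬝ᵥ v = 0 := Iff.rfl

omit [DecidableEq ι] in
theorem mem_orth_comm {v f : ι → F} : f ∈ orth v ↔ v ∈ orth f := by
  rw [mem_orth, mem_orth, dotProduct_comm]

/-- The group of transvections with a given centre. -/
def elationHom (v : ι → F) : Multiplicative (orth v) →* SpecialLinearGroup ι F where
  toFun f := elation v f.toAdd f.toAdd.2
  map_one' := (elation_eq_one_iff _).2 (Or.inr rfl)
  map_mul' _ _ := (elation_mul_elation_right _ _).symm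

/-- The group of transvections with a given axis. -/
def coelationHom (f : ι → F) : Multiplicative (orth f) →* SpecialLinearGroup ι F where
  toFun v := elation v.toAdd f (mem_orth_comm.1 v.toAdd.2)
  map_one' := (elation_eq_one_iff _).2 (Or.inl rfl)
  map_mul' _ _ := (elation_mul_elation_left _ _).symm

theorem single_dotProduct_single_of_ne {i j : ι} (hij : i ≠ j) (a b : F) :
    Pi.single j a ⬝ᵥ Pi.single i b = 0 := by
  simp [hij]

theorem transvection_eq_elation {i j : ι} (hij : i ≠ j) (b : F) :
    transvection hij b = elation (Pi.single i 1) (Pi.single j b)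
      (single_dotProduct_single_of_ne hij b 1) := by
  apply Subtype.ext
  rw [transvection_coe, coe_elation]
  congr 1
  ext k l
  simp [vecMulVec_apply, single_apply, Pi.single_apply]
  grind

theorem transvection_eq_elation' {i j : ι} (hij : i ≠ j) (b : F) :
    transvection hij b = elation (Pi.single i b) (Pi.single j 1)
      (single_dotProduct_single_of_ne hij 1 b) := by
  apply Subtype.ext
  rw [transvection_coe, coe_elation]
  congr 1
  ext k l
  simp [vecMulVec_apply, single_apply, Pi.single_apply]
  grind

theorem diag2n_decompose {i j : ι} (hij : i ≠ j) (a : F) (ha : a ≠ 0) :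
    diag2n hij a ha = transvection hij a * transvection hij.symm (- a⁻¹) * transvection hij a *
      transvection hij (-1) * transvection hij.symm 1 * transvection hij (-1) := by
  apply Subtype.ext
  have h : diagonal (fun k => if k = i then a else if k = j then a⁻¹ else 1) =
      1 + single i i (a - 1) + single j j (a⁻¹ - 1) := by
    ext k l
    simp only [diagonal_apply, Matrix.add_apply, Matrix.one_apply, single_apply]
    grind
  rw [diag2n_coe, h]
  simp only [coe_mul, transvection_coe, mul_add, add_mul, mul_one, one_mul, single_mul_single_same,
    single_mul_single_of_ne _ _ _ _ hij, single_mul_single_of_ne _ _ _ _ hij.symm]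
  simp [ha]
  ext k l
  simp only [Matrix.add_apply, Matrix.one_apply, single_apply]
  grind

theorem closure_transvection_eq_top [Nontrivial ι] (H : Subgroup (SpecialLinearGroup ι F))
    (h : ∀ (i j : ι) (hij : i ≠ j) (b : F), transvection hij b ∈ H) : H = ⊤ := by
  rw [eq_top_iff]
  refine fun g _ => diagonal_transvection_induction' (· ∈ H) g (fun i j hij c hc => ?_) h
    fun _ _ => H.mul_mem
  rw [diag2n_decompose]
  exact H.mul_mem (H.mul_mem (H.mul_mem (H.mul_mem (H.mul_mem (h _ _ _ _) (h _ _ _ _)) (h _ _ _ _))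
    (h _ _ _ _)) (h _ _ _ _)) (h _ _ _ _)

theorem transvection_commutator {i j k : ι} (hij : i ≠ j) (hjk : j ≠ k) (hik : i ≠ k) (b : F) :
    transvection hij b * transvection hjk 1 * (transvection hij b)⁻¹ * (transvection hjk 1)⁻¹ =
      transvection hik b := by
  rw [transvection_inv, transvection_inv]
  apply Subtype.ext
  simp [transvection_coe, mul_add, add_mul, single_mul_single_of_ne _ _ _ _ hik.symm,
    single_mul_single_of_ne _ _ _ _ hij.symm, single_mul_single_of_ne _ _ _ _ hjk.symm]
  ext r s
  simp only [Matrix.add_apply, Matrix.one_apply, single_apply]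
  grind

theorem eq_top_of_transvection_mem [Nontrivial ι] (H : Subgroup (SpecialLinearGroup ι F)) (o : ι)
    (h : ∀ (i : ι) (hi : o ≠ i) (b : F), transvection hi b ∈ H ∧ transvection hi.symm b ∈ H) :
    H = ⊤ := by
  refine closure_transvection_eq_top H fun i j hij b => ?_
  by_cases hi : o = i
  · subst hi
    exact (h j hij b).1
  by_cases hj : o = j
  · subst hj
    exact (h i hi b).2
  rw [← transvection_commutator (Ne.symm hi) hj hij]
  exact H.mul_mem (H.mul_mem (H.mul_mem (h i hi b).2 (h j hj 1).1) (H.inv_mem (h i hi b).2))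
    (H.inv_mem (h j hj 1).1)

/-- Row vectors supported on a set of at least two coordinates can be moved to a standard one by
transvections fixing the other coordinate vectors. -/
theorem exists_vecMul_eq_single {f : ι → F} (hf : f ≠ 0) {p : ι → Prop}
    (hp : ∀ i, ¬ p i → f i = 0) {b c : ι} (hb : p b) (hc : p c) (hbc : b ≠ c) :
    ∃ g : SpecialLinearGroup ι F, f ᵥ* g.1 = Pi.single b 1 ∧
      ∀ i, ¬ p i → g.1 *ᵥ Pi.single i 1 = Pi.single i 1 := by
  have key1 (f : ι → F) (hp : ∀ i, ¬ p i → f i = 0) (hfb : f b = 1) :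
      ∃ g : SpecialLinearGroup ι F, f ᵥ* g.1 = Pi.single b 1 ∧
        ∀ i, ¬ p i → g.1 *ᵥ Pi.single i 1 = Pi.single i 1 := by
    refine ⟨elation (Pi.single b 1) (Pi.single b 1 - f) (by simp [hfb]), ?_, fun i hi => ?_⟩
    · rw [coe_elation, vecMul_add, vecMul_one, vecMul_vecMulVec]
      simp [hfb]
    · have : b ≠ i := by rintro rfl; exact hi hb
      rw [coe_elation, add_mulVec, one_mulVec, vecMulVec_mulVec]
      simp [hp i hi, this]
  have key2 (f : ι → F) (hp : ∀ i, ¬ p i → f i = 0) {k : ι} (hk : p k) (hkb : k ≠ b)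
      (hfk : f k ≠ 0) :
      ∃ g : SpecialLinearGroup ι F, f ᵥ* g.1 = Pi.single b 1 ∧
        ∀ i, ¬ p i → g.1 *ᵥ Pi.single i 1 = Pi.single i 1 := by
    have hpb (i) (hi : ¬ p i) : i ≠ b := by rintro rfl; exact hi hb
    have hT : f ᵥ* (transvection hkb ((1 - f b) / f k)).1 = f + Pi.single b (1 - f b) := by
      rw [transvection_eq_elation, coe_elation, vecMul_add, vecMul_one, vecMul_vecMulVec]
      ext i
      by_cases hi : i = b <;> simp [hi]
      field_simp
      ring
    obtain ⟨g, hg, hg'⟩ := key1 (f ᵥ* (transvection hkb ((1 - f b) / f k)).1)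
      (fun i hi => by simp [hT, hp i hi, hpb i hi]) (by simp [hT])
    refine ⟨transvection hkb ((1 - f b) / f k) * g, ?_, fun i hi => ?_⟩
    · rw [coe_mul, ← vecMul_vecMul, hg]
    · rw [coe_mul, ← mulVec_mulVec, hg' i hi, transvection_eq_elation, coe_elation, add_mulVec,
        one_mulVec, vecMulVec_mulVec]
      simp [hpb i hi]
  by_cases hk : ∃ k, p k ∧ k ≠ b ∧ f k ≠ 0
  · obtain ⟨k, hk, hkb, hfk⟩ := hk
    exact key2 f hp hk hkb hfk
  · push Not at hk
    have hfb : f b ≠ 0 := fun h => hf <| funext fun i => by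
      by_cases hi : i = b
      · rw [hi, h, Pi.zero_apply]
      · by_cases hpi : p i
        · exact hk i hpi hi
        · exact hp i hpi
    have hpc (i) (hi : ¬ p i) : i ≠ c := by rintro rfl; exact hi hc
    have hT : f ᵥ* (transvection hbc 1).1 = f + Pi.single c (f b) := by
      rw [transvection_eq_elation, coe_elation, vecMul_add, vecMul_one, vecMul_vecMulVec]
      ext i
      by_cases hi : i = c <;> simp [hi]
    obtain ⟨g, hg, hg'⟩ := key2 (f ᵥ* (transvection hbc 1).1)
      (fun i hi => by simp [hT, hp i hi, hpc i hi]) hc hbc.symm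
      (by simp [hT, hk c hc hbc.symm, hfb])
    refine ⟨transvection hbc 1 * g, ?_, fun i hi => ?_⟩
    · rw [coe_mul, ← vecMul_vecMul, hg]
    · rw [coe_mul, ← mulVec_mulVec, hg' i hi, transvection_eq_elation, coe_elation, add_mulVec,
        one_mulVec, vecMulVec_mulVec]
      simp [hpc i hi]

theorem exists_mulVec_single_eq {v : ι → F} (hv : v ≠ 0) {a b : ι} (hab : a ≠ b) :
    ∃ g : SpecialLinearGroup ι F, g.1 *ᵥ Pi.single a 1 = v := by
  obtain ⟨g, hg, -⟩ := exists_vecMul_eq_single hv (p := fun _ => True) (by simp) (b := a) (c := b)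
    trivial trivial hab
  refine ⟨(g.transpose)⁻¹, ?_⟩
  rw [← hg, ← mulVec_transpose, ← coe_transpose, mulVec_mulVec, coe_inv_mul_coe, one_mulVec]

/-- In dimension at least three all nontrivial transvections are conjugate. -/
theorem exists_conj_eq_elation {v f : ι → F} (h : f ⬝ᵥ v = 0) (hv : v ≠ 0) (hf : f ≠ 0)
    {a b c : ι} (hab : a ≠ b) (hac : a ≠ c) (hbc : b ≠ c) :
    ∃ g : SpecialLinearGroup ι F, g * transvection hab 1 * g⁻¹ = elation v f h := by
  obtain ⟨g, rfl⟩ := exists_mulVec_single_eq hv hab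
  have hne : f ᵥ* g.1 ≠ 0 := fun h0 => hf <| by
    rw [← vecMul_one f, ← coe_mul_coe_inv g, ← vecMul_vecMul, h0, zero_vecMul]
  obtain ⟨x, hx, hx'⟩ := exists_vecMul_eq_single hne (p := fun i => i ≠ a) (b := b) (c := c)
    (by
      intro i hi
      rw [not_not] at hi
      subst hi
      rw [dotProduct_mulVec] at h
      simpa using h) hab.symm hac.symm hbc
  have hx1 : x.1 *ᵥ Pi.single a 1 = Pi.single a 1 := hx' a (by simp)
  refine ⟨g * x, ?_⟩
  rw [transvection_eq_elation, conj_elation]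
  have h1 : (g * x).1 *ᵥ Pi.single a 1 = g.1 *ᵥ Pi.single a 1 := by
    rw [coe_mul, ← mulVec_mulVec, hx1]
  have h2 : Pi.single b 1 ᵥ* ((g * x)⁻¹ : SpecialLinearGroup ι F).1 = f := by
    rw [← hx, vecMul_vecMul f, ← coe_mul, vecMul_vecMul, coe_mul_coe_inv, vecMul_one]
  apply Subtype.ext
  rw [coe_elation, coe_elation, h1, h2]

end Elation

section Ratio

open Matrix.SpecialLinearGroup

variable {ι F : Type*} [Fintype ι] [DecidableEq ι] [Field F] [Fintype F]
  {κ : Type*} [Fintype κ] [DecidableEq κ]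

theorem card_sub_one_le_two_mul_card [Nontrivial ι] (σ : SpecialLinearGroup ι F →* Matrix κ κ ℂ)
    (h : ∃ g, σ g ≠ 1) : (Fintype.card F : ℝ) - 1 ≤ 2 * Fintype.card κ := by
  classical
  obtain ⟨i, j, hij, s, hs⟩ : ∃ (i j : ι) (hij : i ≠ j) (s : F), σ (transvection hij s) ≠ 1 := by
    by_contra! h1
    obtain ⟨g, hg⟩ := h
    have : σ.ker = ⊤ := closure_transvection_eq_top _ h1
    exact hg (this ▸ Subgroup.mem_top g : g ∈ σ.ker)
  let τ : Multiplicative F →* Matrix κ κ ℂ := σ.comp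
    { toFun := fun s => transvection hij s.toAdd
      map_one' := transvection_coeff_zero hij
      map_mul' := fun a b => transvection_add hij _ _ }
  refine card_sub_one_le_of_scaling τ (fun a => if ha : a = 0 then 1 else σ (diag2n hij a ha))
    (fun a => if ha : a = 0 then 1 else σ (diag2n hij a ha)⁻¹) (fun a ha => ?_) (fun a ha s => ?_)
    ⟨.ofAdd s, hs⟩
  · rw [dif_neg ha, dif_neg ha, ← map_mul, mul_inv_cancel, map_one]
  · rw [dif_neg ha, dif_neg ha]
    change σ _ * σ (transvection hij s) * σ _ = σ (transvection hij (a ^ 2 * s))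
    rw [← map_mul, ← map_mul]
    congr 1
    rw [mul_inv_eq_iff_eq_mul]
    apply Subtype.ext
    rw [coe_mul, coe_mul, transvection_coe, transvection_coe, diag2n_coe]
    ext k l
    simp only [mul_add, add_mul, Matrix.add_apply, diagonal_mul, mul_diagonal,
      single_apply]
    grind [Matrix.one_apply]

theorem card_mul_le_of_ne_top {A : Type*} [AddCommGroup A] [Module F A] [Fintype A]
    {S : Submodule F A} (hS : S ≠ ⊤) : Nat.card S * Fintype.card F ≤ Fintype.card A := by
  classical
  rw [Nat.card_eq_fintype_card, Module.card_eq_pow_finrank (K := F) (V := S),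
    Module.card_eq_pow_finrank (K := F) (V := A), ← pow_succ]
  exact Nat.pow_le_pow_right Fintype.card_pos (Submodule.finrank_lt hS)

theorem norm_trace_sq_le_of_commutator {G : Type*} [Group G] {σ : G →* Matrix κ κ ℂ}
    (hσ : ∀ g, (σ g)ᴴ = σ g⁻¹) {A : Type*} [AddCommGroup A] [Module F A] [Fintype A]
    {S : Submodule F A} (hS : S ≠ ⊤) (ψ : Multiplicative A →* G) (g : G) {ε : ℝ} (hε : ε ≤ 1)
    (h : ∀ a ∉ S, ‖(σ (g * ψ (.ofAdd a) * g⁻¹ * (ψ (.ofAdd a))⁻¹)).trace‖ ≤ ε * Fintype.card κ) :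
    ‖(σ g).trace‖ ^ 2 ≤ (ε + (1 - ε) / Fintype.card F) * (Fintype.card κ : ℝ) ^ 2 := by
  classical
  have hA : (0 : ℝ) < Fintype.card A := by exact_mod_cast Fintype.card_pos
  have hF : (0 : ℝ) < Fintype.card F := by exact_mod_cast Fintype.card_pos
  have hcard : (Nat.card S : ℝ) * Fintype.card F ≤ Fintype.card A := by
    exact_mod_cast card_mul_le_of_ne_top hS
  have hsum : ∑ a : Multiplicative A, ‖(σ (g * ψ a * g⁻¹ * (ψ a)⁻¹)).trace‖ ≤
      (ε * Fintype.card A + (1 - ε) * Nat.card S) * Fintype.card κ := by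
    calc _ = ∑ a : A, ‖(σ (g * ψ (.ofAdd a) * g⁻¹ * (ψ (.ofAdd a))⁻¹)).trace‖ :=
          (Equiv.sum_comp Multiplicative.ofAdd _).symm
      _ ≤ ∑ a : A, (ε + if a ∈ S then 1 - ε else 0) * Fintype.card κ := by
          refine Finset.sum_le_sum fun a _ => ?_
          split_ifs with ha
          · rw [add_sub_cancel, one_mul]
            exact norm_trace_le_card hσ _
          · rw [add_zero]
            exact h a ha
      _ = _ := by
          rw [← Finset.sum_mul, Finset.sum_add_distrib, Finset.sum_const, nsmul_eq_mul,
            Finset.card_univ, ← Finset.sum_filter, Finset.sum_const, nsmul_eq_mul,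
            Nat.card_eq_fintype_card, Fintype.card_subtype]
          ring
  refine (norm_trace_sq_le_sum_commutator hσ ψ g).trans ?_
  rw [Fintype.card_multiplicative]
  calc _ ≤ (Fintype.card κ : ℝ) * ((Fintype.card A : ℝ)⁻¹ *
        ((ε * Fintype.card A + (1 - ε) * Nat.card S) * Fintype.card κ)) := by gcongr
    _ = (ε + (1 - ε) * ((Nat.card S : ℝ) / Fintype.card A)) * (Fintype.card κ : ℝ) ^ 2 := by
        field_simp
    _ ≤ _ := by
        have : (Nat.card S : ℝ) / Fintype.card A ≤ 1 / Fintype.card F := by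
          rw [div_le_div_iff₀ hA hF, one_mul]
          exact hcard
        rw [div_eq_mul_one_div (1 - ε)]
        have h1 : 0 ≤ 1 - ε := by linarith
        gcongr

omit [Fintype F] [DecidableEq ι] in
theorem exists_ne_zero_mem_orth (hι : 3 ≤ Fintype.card ι) (v w : ι → F) :
    ∃ u ≠ 0, u ∈ orth v ∧ u ∈ orth w := by
  let T : (ι → F) →ₗ[F] F × F :=
    { toFun := fun u => (u ⬝ᵥ v, u ⬝ᵥ w)
      map_add' := fun a b => by simp [add_dotProduct]
      map_smul' := fun a b => by simp [smul_dotProduct] }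
  have : LinearMap.ker T ≠ ⊥ := LinearMap.ker_ne_bot_of_finrank_lt (by
    simp
    omega)
  obtain ⟨u, hu, hu0⟩ := Submodule.exists_mem_ne_zero_of_ne_bot this
  rw [LinearMap.mem_ker] at hu
  exact ⟨u, hu0, congrArg Prod.fst hu, congrArg Prod.snd hu⟩

omit [Fintype F] in
theorem elation_inv {v f : ι → F} (h : f ⬝ᵥ v = 0) :
    (elation v f h)⁻¹ = elation v (-f) (by rw [neg_dotProduct, h, neg_zero]) := by
  rw [inv_eq_iff_mul_eq_one, elation_mul_elation_right]
  exact (elation_eq_one_iff _).2 (Or.inr (by simp))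

omit [Fintype F] in
theorem exists_eq_elation {x : SpecialLinearGroup ι F} {v : ι → F} (hv : v ≠ 0)
    (hx : x.1 *ᵥ v = v) (h : ∀ f ∈ orth v, f ᵥ* x.1 = f) :
    ∃ (k : ι → F) (hk : k ⬝ᵥ v = 0), x = elation v k hk := by
  obtain ⟨i, hi⟩ := Function.ne_iff.1 hv
  rw [Pi.zero_apply] at hi
  let k : ι → F := fun l => (x.1 - 1) i l / v i
  have hk : x.1 = 1 + vecMulVec v k := by
    rw [← sub_eq_iff_eq_add']
    ext j l
    have h1 := congrFun (h (Pi.single j (v i) - Pi.single i (v j)) (by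
      rw [mem_orth, sub_dotProduct]
      simp [mul_comm])) l
    rw [sub_vecMul] at h1
    simp [Pi.single_apply] at h1
    simp only [vecMulVec_apply, k, Matrix.sub_apply, Matrix.one_apply]
    grind
  have hkv : k ⬝ᵥ v = 0 := by
    rw [hk, add_mulVec, one_mulVec, vecMulVec_mulVec, add_eq_left] at hx
    simpa [hi] using congrFun hx i
  exact ⟨k, hkv, Subtype.ext hk⟩

variable {σ : SpecialLinearGroup ι F →* Matrix κ κ ℂ} (hσ : ∀ g, (σ g)ᴴ = σ g⁻¹) {c : ℝ}
  (hc0 : 0 ≤ c) (hc1 : c ≤ 1)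
  (hc : ∀ (v f : ι → F) (h : f ⬝ᵥ v = 0), v ≠ 0 → f ≠ 0 →
    ‖(σ (elation v f h)).trace‖ ≤ c * Fintype.card κ)

include hσ hc0 hc1 hc in
theorem norm_trace_sq_le_of_mulVec_eq {x : SpecialLinearGroup ι F} (hx1 : x ≠ 1) {v : ι → F}
    (hv : v ≠ 0) (hx : x.1 *ᵥ v = v) :
    ‖(σ x).trace‖ ^ 2 ≤ (c + (1 - c) / Fintype.card F) * (Fintype.card κ : ℝ) ^ 2 := by
  classical
  have hxv : (x⁻¹ : SpecialLinearGroup ι F).1 *ᵥ v = v := by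
    nth_rw 1 [← hx]
    rw [mulVec_mulVec, coe_inv_mul_coe, one_mulVec]
  let S : Submodule F (orth v) := LinearMap.ker
    ((vecMulLinear (x⁻¹ : SpecialLinearGroup ι F).1 - LinearMap.id) ∘ₗ (orth v).subtype)
  have hS (f : orth v) : f ∈ S ↔ f.1 ᵥ* (x⁻¹ : SpecialLinearGroup ι F).1 = f.1 := by
    rw [LinearMap.mem_ker]
    exact sub_eq_zero
  by_cases hST : S = ⊤
  · obtain ⟨k, hk, rfl⟩ := exists_eq_elation hv hx fun f hf => by
      have : f ᵥ* (x⁻¹ : SpecialLinearGroup ι F).1 = f :=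
        (hS ⟨f, hf⟩).1 (hST ▸ Submodule.mem_top)
      nth_rw 1 [← this]
      rw [vecMul_vecMul, coe_inv_mul_coe, vecMul_one]
    have hk0 : k ≠ 0 := by
      rintro rfl
      exact hx1 ((elation_eq_one_iff _).2 (Or.inr rfl))
    have h0 : 0 ≤ (1 - c) / Fintype.card F := div_nonneg (by linarith) (by positivity)
    calc _ ≤ (c * Fintype.card κ) ^ 2 := by
          gcongr
          exact hc v k hk hv hk0
      _ ≤ _ := by
          rw [mul_pow]
          gcongr
          nlinarith
  · refine norm_trace_sq_le_of_commutator hσ hST (elationHom v) x hc1 fun f hf => ?_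
    rw [hS] at hf
    have hfv : (f.1 ᵥ* (x⁻¹ : SpecialLinearGroup ι F).1) ⬝ᵥ v = 0 := by
      rw [← dotProduct_mulVec, hxv]
      exact mem_orth.1 f.2
    have h1 : x * elationHom v (.ofAdd f) * x⁻¹ * (elationHom v (.ofAdd f))⁻¹ =
        elation v (f.1 ᵥ* (x⁻¹ : SpecialLinearGroup ι F).1 - f.1)
          (by rw [sub_dotProduct, hfv, mem_orth.1 f.2, sub_zero]) := by
      change x * elation v f.1 (mem_orth.1 f.2) * x⁻¹ * (elation v f.1 (mem_orth.1 f.2))⁻¹ = _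
      rw [conj_elation, elation_inv]
      simp_rw [hx]
      rw [elation_mul_elation_right]
      simp_rw [sub_eq_add_neg]
    rw [h1]
    exact hc _ _ _ hv (sub_ne_zero.2 hf)

include hσ in
theorem norm_trace_sq_le_of_notMem_center (hι : 3 ≤ Fintype.card ι) {ε : ℝ} (hε : ε ≤ 1)
    (h : ∀ x : SpecialLinearGroup ι F, x ≠ 1 → (∃ v ≠ 0, x.1 *ᵥ v = v) →
      ‖(σ x).trace‖ ≤ ε * Fintype.card κ)
    {g : SpecialLinearGroup ι F} (hg : g ∉ Subgroup.center (SpecialLinearGroup ι F)) :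
    ‖(σ g).trace‖ ^ 2 ≤ (ε + (1 - ε) / Fintype.card F) * (Fintype.card κ : ℝ) ^ 2 := by
  classical
  obtain ⟨v, hv⟩ : ∃ v, LinearIndependent F ![v, g.1.mulVecLin v] := by
    by_contra! hcon
    obtain ⟨a, ha⟩ := LinearMap.exists_eq_smul_id_of_forall_notLinearIndependent hcon
    have ha' : g.1 = scalar ι a := by
      ext i j
      have := congrFun (LinearMap.congr_fun ha (Pi.single j 1)) i
      simpa [Pi.single_apply, diagonal_apply] using this
    refine hg (mem_center_iff.2 ⟨a, ?_, ha'.symm⟩)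
    have := g.2
    rw [ha', scalar_apply, det_diagonal, Finset.prod_const, Finset.card_univ] at this
    exact this
  rw [LinearIndependent.pair_iff] at hv
  obtain ⟨u, hu0, hu, -⟩ := exists_ne_zero_mem_orth hι v v
  have hbot : (⊥ : Submodule F (orth v)) ≠ ⊤ := by
    intro hbt
    have : (⟨u, hu⟩ : orth v) ∈ (⊥ : Submodule F (orth v)) := hbt ▸ Submodule.mem_top
    exact hu0 (congrArg Subtype.val ((Submodule.mem_bot F).1 this))
  refine norm_trace_sq_le_of_commutator hσ hbot (elationHom v) g hε fun f hf => ?_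
  rw [Submodule.mem_bot] at hf
  have hf0 : f.1 ≠ 0 := fun h0 => hf (Subtype.ext h0)
  have hfv := mem_orth.1 f.2
  change ‖(σ (g * elation v f.1 hfv * g⁻¹ * (elation v f.1 hfv)⁻¹)).trace‖ ≤ _
  rw [conj_elation]
  refine h _ (fun h1 => ?_) ?_
  · rw [mul_inv_eq_one] at h1
    have h2 := add_left_cancel (congrArg Subtype.val h1 : (1 : Matrix ι ι F) + _ = 1 + _)
    obtain ⟨l, hl⟩ := Function.ne_iff.1 hf0
    have h3 := hv (-f.1 l) ((f.1 ᵥ* (g⁻¹ : SpecialLinearGroup ι F).1) l) (by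
      ext i
      have := congrFun (congrFun h2 i) l
      simp only [vecMulVec_apply] at this
      simp only [mulVecLin_apply, Pi.add_apply, Pi.smul_apply, smul_eq_mul, Pi.zero_apply]
      linear_combination this)
    exact hl (neg_eq_zero.1 h3.1)
  · obtain ⟨w, hw0, hw1, hw2⟩ := exists_ne_zero_mem_orth hι f.1
      (f.1 ᵥ* (g⁻¹ : SpecialLinearGroup ι F).1)
    refine ⟨w, hw0, ?_⟩
    rw [mem_orth, dotProduct_comm] at hw1 hw2
    have h1 : (elation v (-f.1) (by rw [neg_dotProduct, hfv, neg_zero])).1 *ᵥ w = w := by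
      rw [coe_elation, add_mulVec, one_mulVec, vecMulVec_mulVec, neg_dotProduct, hw1]
      simp
    rw [elation_inv, coe_mul, ← mulVec_mulVec, h1, coe_elation, add_mulVec, one_mulVec,
      vecMulVec_mulVec, hw2]
    simp

end Ratio

section ElationTrace

open Matrix.SpecialLinearGroup

variable {ι F : Type*} [Fintype ι] [DecidableEq ι] [Field F]
  {κ : Type*} [Fintype κ] [DecidableEq κ]

theorem trace_elation_eq (hι : 3 ≤ Fintype.card ι) (σ : SpecialLinearGroup ι F →* Matrix κ κ ℂ)
    {v f v' f' : ι → F} (h : f ⬝ᵥ v = 0) (h' : f' ⬝ᵥ v' = 0) (hv : v ≠ 0) (hf : f ≠ 0)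
    (hv' : v' ≠ 0) (hf' : f' ≠ 0) :
    (σ (elation v f h)).trace = (σ (elation v' f' h')).trace := by
  obtain ⟨a, b, c, hab, hac, hbc⟩ := Fintype.two_lt_card_iff.1 hι
  obtain ⟨g, hg⟩ := exists_conj_eq_elation h hv hf hab hac hbc
  obtain ⟨g', hg'⟩ := exists_conj_eq_elation h' hv' hf' hab hac hbc
  rw [← hg, ← hg', trace_conj_eq, trace_conj_eq]

theorem two_mul_norm_trace_elation_le [Fintype F] (hι : 3 ≤ Fintype.card ι)
    {σ : SpecialLinearGroup ι F →* Matrix κ κ ℂ} [Fintype (SpecialLinearGroup ι F)]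
    (hσ : ∀ g, (σ g)ᴴ = σ g⁻¹)
    (hnorm : ∑ g, ‖(σ g).trace‖ ^ 2 = Fintype.card (SpecialLinearGroup ι F))
    (hne : ∃ g, (σ g).trace ≠ 1) {v f : ι → F} (h : f ⬝ᵥ v = 0) (hv : v ≠ 0) (hf : f ≠ 0) :
    2 * ‖(σ (elation v f h)).trace‖ ≤ Fintype.card κ := by
  classical
  obtain ⟨a, b, c, hab, hac, hbc⟩ := Fintype.two_lt_card_iff.1 hι
  have : Nontrivial ι := ⟨a, b, hab⟩
  have ha : (Pi.single a 1 : ι → F) ≠ 0 := by simp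
  have hb : (Pi.single b 1 : ι → F) ∈ orth (Pi.single a 1) := by simp [mem_orth, hab.symm]
  have hc : (Pi.single c 1 : ι → F) ∈ orth (Pi.single a 1) := by simp [mem_orth, hac.symm]
  refine two_mul_norm_le_of_abelian hσ hnorm hne (A := orth (Pi.single a 1 : ι → F))
    ?_ (elationHom _) (coelationHom _) ?_ (fun x hx => ?_) (fun x hx => ?_)
  · refine Fintype.two_lt_card_iff.2 ⟨0, ⟨_, hb⟩, ⟨_, hc⟩, ?_, ?_, ?_⟩
    · exact fun h => by simpa using congrFun (congrArg Subtype.val h) b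
    · exact fun h => by simpa using congrFun (congrArg Subtype.val h) c
    · exact fun h => by simpa [hbc] using congrFun (congrArg Subtype.val h) b
  · refine eq_top_of_transvection_mem _ a fun i hi s => ⟨?_, ?_⟩
    · refine Subgroup.subset_closure (Or.inl
        ⟨.ofAdd ⟨Pi.single i s, single_dotProduct_single_of_ne hi _ _⟩, ?_⟩)
      rw [transvection_eq_elation]
      rfl
    · refine Subgroup.subset_closure (Or.inr
        ⟨.ofAdd ⟨Pi.single i s, single_dotProduct_single_of_ne hi _ _⟩, ?_⟩)
      rw [transvection_eq_elation']
      rfl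
  · exact trace_elation_eq hι σ (mem_orth.1 x.toAdd.2) h ha (fun h0 => hx (Subtype.ext h0)) hv hf
  · exact trace_elation_eq hι σ (mem_orth_comm.1 x.toAdd.2) h
      (fun h0 => hx (Subtype.ext h0)) ha hv hf

end ElationTrace

section Blocks

variable {F : Type*} [Field F]

theorem card_SL_two [Fintype F] [DecidableEq F] :
    Fintype.card SL(2, F) = Fintype.card F * (Fintype.card F ^ 2 - 1) := by
  have hq : 1 < Fintype.card F := Fintype.one_lt_card
  have hGL := Matrix.card_GL_field (𝔽 := F) 2
  have hdet : Function.Surjective (GeneralLinearGroup.det (n := Fin 2) (R := F)) := by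
    intro u
    refine ⟨GeneralLinearGroup.mkOfDetNeZero !![(u : F), 0; 0, 1] (by simp), Units.ext ?_⟩
    simp [GeneralLinearGroup.mkOfDetNeZero]
  have hker : Nat.card (GeneralLinearGroup.det (n := Fin 2) (R := F)).ker =
      Fintype.card SL(2, F) := by
    rw [← Nat.card_eq_fintype_card, ← Nat.card_range_of_injective
      SpecialLinearGroup.toGL_injective, SpecialLinearGroup.range_toGL]
    rfl
  have h := Subgroup.card_mul_index (GeneralLinearGroup.det (n := Fin 2) (R := F)).ker
  rw [Subgroup.index_ker, MonoidHom.range_eq_top.2 hdet, Subgroup.card_top, hGL, hker,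
    Nat.card_units, Nat.card_eq_fintype_card, Fin.prod_univ_two] at h
  generalize Fintype.card F = q at *
  obtain ⟨q, rfl⟩ := Nat.exists_eq_add_of_lt hq
  have h1 : ∀ x : ℕ, 1 + x + 1 - 1 = x + 1 := fun x => by omega
  have h2 : (1 + q + 1) ^ 2 - 1 = (q + 1) * (q + 3) := by
    rw [Nat.sub_eq_iff_eq_add (by nlinarith)]
    ring
  have h3 : (1 + q + 1) ^ 2 - (1 + q + 1) = (q + 1) * (q + 2) := by
    rw [Nat.sub_eq_iff_eq_add (by nlinarith)]
    ring
  simp only [Fin.val_zero, pow_zero, Fin.val_one, pow_one, h1, h2, h3] at h ⊢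
  apply Nat.eq_of_mul_eq_mul_right (Nat.succ_pos q)
  rw [h, Nat.succ_eq_add_one]
  ring

/-- A nonzero linear functional on the plane has at most `|F|` unimodular stabilizers. -/
theorem card_stabilizer_dual_le [Fintype F] {L : (Fin 2 → F) →ₗ[F] F} (hL : L ≠ 0) :
    Nat.card {k : SL(2, F) | ∀ u, L (k.1 *ᵥ u) = L u} ≤ Fintype.card F := by
  have hLu (u : Fin 2 → F) : L u = u 0 * L (Pi.single 0 1) + u 1 * L (Pi.single 1 1) := by
    have : u = u 0 • Pi.single 0 1 + u 1 • Pi.single 1 1 := by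
      ext i
      fin_cases i <;> simp
    conv_lhs => rw [this]
    simp only [map_add, map_smul, smul_eq_mul]
  have hk (k : SL(2, F)) (h : ∀ u, L (k.1 *ᵥ u) = L u) :
      k.1 0 0 * L (Pi.single 0 1) + k.1 1 0 * L (Pi.single 1 1) = L (Pi.single 0 1) ∧
      k.1 0 1 * L (Pi.single 0 1) + k.1 1 1 * L (Pi.single 1 1) = L (Pi.single 1 1) := by
    have h0 := h (Pi.single 0 1)
    have h1 := h (Pi.single 1 1)
    rw [hLu] at h0 h1
    simpa using And.intro h0 h1
  have hdet (k : SL(2, F)) : k.1 0 0 * k.1 1 1 - k.1 0 1 * k.1 1 0 = 1 := by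
    rw [← det_fin_two]
    exact k.2
  rw [← Nat.card_eq_fintype_card]
  by_cases hr : L (Pi.single 1 1) = 0
  · have hp : L (Pi.single 0 1) ≠ 0 := fun hp => hL (by
      ext u
      fin_cases u
      · simpa using hp
      · simpa using hr)
    refine Nat.card_le_card_of_injective (fun k => k.1.1 1 0) fun k l hkl => ?_
    have := hk _ k.2
    have := hk _ l.2
    have := hdet k
    have := hdet l
    ext i j
    fin_cases i <;> fin_cases j <;> simp at * <;> grind
  · refine Nat.card_le_card_of_injective (fun k => k.1.1 0 1) fun k l hkl => ?_
    have := hk _ k.2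
    have := hk _ l.2
    have := hdet k
    have := hdet l
    ext i j
    fin_cases i <;> fin_cases j <;> simp at * <;> grind

theorem card_stabilizer_addChar_le [Fintype F] {ψ : AddChar (Fin 2 → F) ℂ} (hψ : ψ ≠ 0) :
    Nat.card {k : SL(2, F) | ∀ u, ψ (k.1 *ᵥ u) = ψ u} ≤ Fintype.card F := by
  classical
  let S : Submodule F (Fin 2 → F) :=
    { carrier := {u | ∀ s : F, ψ (s • u) = 1}
      add_mem' := fun {a b} ha hb s => by rw [smul_add, AddChar.map_add_eq_mul, ha, hb, one_mul]
      zero_mem' := fun s => by rw [smul_zero, AddChar.map_zero_eq_one]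
      smul_mem' := fun c x hx s => by rw [smul_smul]; exact hx _ }
  have hS : S < ⊤ := by
    obtain ⟨u, hu⟩ := (AddChar.ne_zero_iff).1 hψ
    refine lt_of_le_of_ne le_top fun h => hu ?_
    have := (h ▸ Submodule.mem_top : u ∈ S) 1
    rwa [one_smul] at this
  obtain ⟨L, hL, hSL⟩ := Submodule.exists_le_ker_of_lt_top S hS
  have hsub : {k : SL(2, F) | ∀ u, ψ (k.1 *ᵥ u) = ψ u} ⊆ {k | ∀ u, L (k.1 *ᵥ u) = L u} := by
    intro k hk u
    rw [← sub_eq_zero, ← map_sub]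
    refine hSL (fun s => ?_)
    rw [smul_sub, ← mulVec_smul, sub_eq_add_neg, AddChar.map_add_eq_mul, hk,
      ← AddChar.map_add_eq_mul, add_neg_cancel, AddChar.map_zero_eq_one]
  exact (Nat.card_mono (Set.toFinite _) hsub).trans (card_stabilizer_dual_le hL)

theorem card_stabilizer_mul_le [Fintype F] {m : Type*} [Fintype m] [DecidableEq m]
    {l : AddChar (Matrix (Fin 2) m F) ℂ} (hl : l ≠ 0) :
    Nat.card {k : SL(2, F) | ∀ a, l (k.1 * a) = l a} ≤ Fintype.card F := by
  classical
  obtain ⟨j, hj⟩ : ∃ j, l.compAddMonoidHom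
      { toFun := fun u : Fin 2 → F => vecMulVec u (Pi.single j (1 : F))
        map_zero' := zero_vecMulVec _
        map_add' := fun _ _ => add_vecMulVec _ _ _ } ≠ 0 := by
    by_contra! h
    refine hl (DFunLike.ext _ _ fun a => ?_)
    have ha : a = ∑ j, vecMulVec (fun i => a i j) (Pi.single j (1 : F)) := by
      ext i k
      simp [Matrix.sum_apply, vecMulVec_apply, Pi.single_apply]
    rw [ha, ← toAdd_ofAdd (∑ j, vecMulVec (fun i => a i j) (Pi.single j (1 : F))), ofAdd_sum]
    refine (map_prod l.toMonoidHom _ _).trans ?_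
    exact Finset.prod_eq_one fun j _ => DFunLike.congr_fun (h j) _
  have hsub : {k : SL(2, F) | ∀ a, l (k.1 * a) = l a} ⊆ {k | ∀ u, l.compAddMonoidHom
      { toFun := fun u : Fin 2 → F => vecMulVec u (Pi.single j (1 : F))
        map_zero' := zero_vecMulVec _
        map_add' := fun _ _ => add_vecMulVec _ _ _ } (k.1 *ᵥ u) = l.compAddMonoidHom
      { toFun := fun u : Fin 2 → F => vecMulVec u (Pi.single j (1 : F))
        map_zero' := zero_vecMulVec _
        map_add' := fun _ _ => add_vecMulVec _ _ _ } u} := by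
    intro k hk u
    have := hk (vecMulVec u (Pi.single j (1 : F)))
    rwa [mul_vecMulVec] at this
  exact (Nat.card_mono (Set.toFinite _) hsub).trans (card_stabilizer_addChar_le hj)

theorem card_stabilizer_mul_inv_le [Fintype F] {m : Type*} [Fintype m] [DecidableEq m]
    {l : AddChar (Matrix m (Fin 2) F) ℂ} (hl : l ≠ 0) :
    Nat.card {k : SL(2, F) | ∀ a, l (a * (k⁻¹ : SL(2, F)).1) = l a} ≤ Fintype.card F := by
  have hl' : l.compAddMonoidHom (transposeAddEquiv (Fin 2) m F).toAddMonoidHom ≠ 0 := by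
    intro h
    refine hl (DFunLike.ext _ _ fun a => ?_)
    exact DFunLike.congr_fun h aᵀ
  refine le_trans ?_ (card_stabilizer_mul_le hl')
  refine Nat.card_le_card_of_injective
    (fun k => ⟨(k.1⁻¹ : SL(2, F)).transpose, fun a => ?_⟩) fun k k' h => ?_
  · have := k.2 aᵀ
    change l ((k.1⁻¹ : SL(2, F)).1ᵀ * a)ᵀ = l aᵀ
    rwa [transpose_mul, transpose_transpose]
  · have h1 : (k.1⁻¹ : SL(2, F)).1ᵀ = (k'.1⁻¹ : SL(2, F)).1ᵀ :=
      congrArg Subtype.val (congrArg Subtype.val h)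
    exact Subtype.ext (inv_injective (Subtype.ext (transpose_injective h1)))

variable {m : Type*} [Fintype m] [DecidableEq m]

/-- The upper left block embedding of `SL₂`. -/
def blockHom : SL(2, F) →* SpecialLinearGroup (Fin 2 ⊕ m) F where
  toFun k := ⟨fromBlocks k.1 0 0 1, by simp [k.2]⟩
  map_one' := Subtype.ext (by simp)
  map_mul' k l := Subtype.ext (by
    change fromBlocks (k.1 * l.1) _ _ _ = fromBlocks _ _ _ _ * fromBlocks _ _ _ _
    simp [fromBlocks_multiply])

/-- The block upper unitriangular matrices. -/
def upperHom : Multiplicative (Matrix (Fin 2) m F) →* SpecialLinearGroup (Fin 2 ⊕ m) F where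
  toFun a := ⟨fromBlocks 1 a.toAdd 0 1, by simp⟩
  map_one' := Subtype.ext (by simp)
  map_mul' a b := Subtype.ext (by
    change fromBlocks _ (a.toAdd + b.toAdd) _ _ = fromBlocks _ _ _ _ * fromBlocks _ _ _ _
    simp [fromBlocks_multiply, add_comm])

/-- The block lower unitriangular matrices. -/
def lowerHom : Multiplicative (Matrix m (Fin 2) F) →* SpecialLinearGroup (Fin 2 ⊕ m) F where
  toFun a := ⟨fromBlocks 1 0 a.toAdd 1, by simp⟩
  map_one' := Subtype.ext (by simp)
  map_mul' a b := Subtype.ext (by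
    change fromBlocks _ _ (a.toAdd + b.toAdd) _ = fromBlocks _ _ _ _ * fromBlocks _ _ _ _
    simp [fromBlocks_multiply])

theorem blockHom_mul_upperHom (k : SL(2, F)) (a : Matrix (Fin 2) m F) :
    blockHom k * upperHom (.ofAdd a) * blockHom k⁻¹ = upperHom (.ofAdd (k.1 * a)) := by
  rw [map_inv, mul_inv_eq_iff_eq_mul]
  refine Subtype.ext ?_
  change fromBlocks k.1 0 0 1 * fromBlocks 1 a 0 1 =
    fromBlocks 1 (k.1 * a) 0 1 * fromBlocks k.1 0 0 1
  simp [fromBlocks_multiply]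

theorem blockHom_mul_lowerHom (k : SL(2, F)) (a : Matrix m (Fin 2) F) :
    blockHom k * lowerHom (.ofAdd a) * blockHom k⁻¹ =
      lowerHom (.ofAdd (a * (k⁻¹ : SL(2, F)).1)) := by
  rw [map_inv, mul_inv_eq_iff_eq_mul]
  refine Subtype.ext ?_
  change fromBlocks k.1 0 0 1 * fromBlocks 1 0 a 1 =
    fromBlocks 1 0 (a * (k⁻¹ : SL(2, F)).1) 1 * fromBlocks k.1 0 0 1
  rw [fromBlocks_multiply, fromBlocks_multiply, Matrix.mul_assoc a, coe_inv_mul_coe]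
  simp

open Matrix.SpecialLinearGroup in
theorem closure_blockHom_upperHom_lowerHom :
    Subgroup.closure (Set.range (blockHom (F := F) (m := m)) ∪ Set.range upperHom ∪
      Set.range lowerHom) = ⊤ := by
  have : Nontrivial (Fin 2 ⊕ m) := ⟨Sum.inl 0, Sum.inl 1, by simp⟩
  refine eq_top_of_transvection_mem _ (Sum.inl 0) fun i hi b => ⟨?_, ?_⟩ <;>
    apply Subgroup.subset_closure
  · rcases i with i | j
    · refine Or.inl (Or.inl ⟨transvection (fun h => hi (congrArg Sum.inl h)) b, ?_⟩)
      apply Subtype.ext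
      change fromBlocks _ _ _ _ = _
      rw [transvection_coe, transvection_coe, ← fromBlocks_one]
      ext (k | k) (l | l) <;> simp [single_apply, Matrix.one_apply]
    · refine Or.inl (Or.inr ⟨.ofAdd (single 0 j b), ?_⟩)
      apply Subtype.ext
      change fromBlocks _ _ _ _ = _
      rw [transvection_coe, ← fromBlocks_one]
      ext (k | k) (l | l) <;> simp [single_apply, Matrix.one_apply]
  · rcases i with i | j
    · refine Or.inl (Or.inl ⟨transvection (fun h => hi (congrArg Sum.inl h.symm)) b, ?_⟩)
      apply Subtype.ext
      change fromBlocks _ _ _ _ = _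
      rw [transvection_coe, transvection_coe, ← fromBlocks_one]
      ext (k | k) (l | l) <;> simp [single_apply, Matrix.one_apply]
    · refine Or.inr ⟨.ofAdd (single j 0 b), ?_⟩
      apply Subtype.ext
      change fromBlocks _ _ _ _ = _
      rw [transvection_coe, ← fromBlocks_one]
      ext (k | k) (l | l) <;> simp [single_apply, Matrix.one_apply]

end Blocks

section BlockBound

open Matrix.SpecialLinearGroup

variable {F : Type*} [Field F] {m : Type*} [Fintype m] [DecidableEq m]

/-- Left multiplication by an element of `SL₂`. -/
def leftMulAddEquiv (k : SL(2, F)) : Matrix (Fin 2) m F ≃+ Matrix (Fin 2) m F where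
  toFun a := k.1 * a
  invFun a := (k⁻¹ : SL(2, F)).1 * a
  left_inv a := (Matrix.mul_assoc _ _ a).symm.trans (by rw [coe_inv_mul_coe, Matrix.one_mul])
  right_inv a := (Matrix.mul_assoc _ _ a).symm.trans (by rw [coe_mul_coe_inv, Matrix.one_mul])
  map_add' := Matrix.mul_add _

/-- Right multiplication by the inverse of an element of `SL₂`. -/
def rightMulInvAddEquiv (k : SL(2, F)) : Matrix m (Fin 2) F ≃+ Matrix m (Fin 2) F where
  toFun a := a * (k⁻¹ : SL(2, F)).1
  invFun a := a * k.1
  left_inv a := (Matrix.mul_assoc a _ _).trans (by rw [coe_inv_mul_coe, Matrix.mul_one])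
  right_inv a := (Matrix.mul_assoc a _ _).trans (by rw [coe_mul_coe_inv, Matrix.mul_one])
  map_add' _ _ := Matrix.add_mul _ _ _

theorem blockHom_elation {v f : Fin 2 → F} (h : f ⬝ᵥ v = 0) :
    blockHom (m := m) (elation v f h) = elation (Sum.elim v 0) (Sum.elim f 0)
      (by rw [sumElim_dotProduct_sumElim, h, zero_dotProduct, add_zero]) := by
  apply Subtype.ext
  rw [coe_elation]
  change fromBlocks (elation v f h).1 0 0 1 = _
  rw [coe_elation, ← fromBlocks_one]
  ext (k | k) (l | l) <;> simp [vecMulVec_apply, Matrix.one_apply]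

variable [Fintype F] {κ : Type*} [Fintype κ] [DecidableEq κ]
  {σ : SpecialLinearGroup (Fin 2 ⊕ m) F →* Matrix κ κ ℂ}

theorem card_mul_card_sub_one_mul_le_sum [Nonempty m] [DecidableEq F] {v f : Fin 2 ⊕ m → F}
    (h : f ⬝ᵥ v = 0) (hv : v ≠ 0) (hf : f ≠ 0) :
    (Fintype.card F : ℝ) * (Fintype.card F - 1) * ‖(σ (elation v f h)).trace‖ ^ 2 ≤
      ∑ k : SL(2, F), ‖(σ (blockHom k)).trace‖ ^ 2 := by
  have hι : 3 ≤ Fintype.card (Fin 2 ⊕ m) := by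
    rw [Fintype.card_sum, Fintype.card_fin]
    have := Fintype.card_pos (α := m)
    omega
  have h0 (p : F × F) : ![-p.1 * p.2, p.2] ⬝ᵥ ![1, p.1] = 0 := by
    simp
    ring
  let t (p : F × Fˣ) : SL(2, F) := elation ![1, p.1] ![-p.1 * (p.2 : F), (p.2 : F)] (h0 (p.1, p.2))
  have ht : Function.Injective t := by
    intro p p' hpp
    have h1 : (1 : Matrix (Fin 2) (Fin 2) F) + _ = 1 + _ := congrArg Subtype.val hpp
    have h2 := add_left_cancel h1
    have h3 := congrFun (congrFun h2 0) 1
    have h4 := congrFun (congrFun h2 0) 0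
    simp [vecMulVec_apply] at h3 h4
    rw [h3] at h4
    exact Prod.ext (by simpa using h4) (Units.ext h3)
  have htr (p : F × Fˣ) : ‖(σ (blockHom (t p))).trace‖ ^ 2 = ‖(σ (elation v f h)).trace‖ ^ 2 := by
    rw [blockHom_elation, trace_elation_eq hι σ _ h _ _ hv hf]
    · exact fun h => by simpa using congrFun h (Sum.inl 0)
    · exact fun h => by simpa using congrFun h (Sum.inl 1)
  calc _ = ∑ p : F × Fˣ, ‖(σ (blockHom (t p))).trace‖ ^ 2 := by
        simp_rw [htr]
        rw [Finset.sum_const, Finset.card_univ, Fintype.card_prod, Fintype.card_units,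
          nsmul_eq_mul, Nat.cast_mul, Nat.cast_sub Fintype.card_pos, Nat.cast_one]
    _ = ∑ k ∈ Finset.univ.map ⟨t, ht⟩, ‖(σ (blockHom k)).trace‖ ^ 2 := by
        rw [Finset.sum_map]
        rfl
    _ ≤ _ := Finset.sum_le_sum_of_subset_of_nonneg (Finset.subset_univ _)
        fun _ _ _ => sq_nonneg _

theorem norm_trace_elation_sq_le [Nonempty m] [Fintype (SpecialLinearGroup (Fin 2 ⊕ m) F)]
    (hσ : ∀ g, (σ g)ᴴ = σ g⁻¹)
    (hnorm : ∑ g, ‖(σ g).trace‖ ^ 2 = Fintype.card (SpecialLinearGroup (Fin 2 ⊕ m) F))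
    {v f : Fin 2 ⊕ m → F} (h : f ⬝ᵥ v = 0) (hv : v ≠ 0) (hf : f ≠ 0) :
    ‖(σ (elation v f h)).trace‖ ^ 2 ≤ (Fintype.card F + 1) *
      (1 + 2 * (Fintype.card κ : ℝ) ^ 2 / ((Fintype.card F : ℝ) ^ 2 - 1)) := by
  classical
  have hq : 1 < Fintype.card F := Fintype.one_lt_card
  have hq2 : 1 < Fintype.card F ^ 2 := Nat.one_lt_pow two_ne_zero hq
  have hM : 0 < Fintype.card F ^ 2 - 1 := by omega
  have havg := average_norm_sq_le hσ hnorm blockHom upperHom lowerHom leftMulAddEquiv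
    blockHom_mul_upperHom rightMulInvAddEquiv blockHom_mul_lowerHom hM
    (fun l hl => by
      rw [card_SL_two]
      exact Nat.mul_le_mul_right _ (card_stabilizer_mul_le hl))
    (fun l hl => by
      rw [card_SL_two]
      exact Nat.mul_le_mul_right _ (card_stabilizer_mul_inv_le hl))
    closure_blockHom_upperHom_lowerHom
  have hsum := card_mul_card_sub_one_mul_le_sum (σ := σ) h hv hf
  rw [card_SL_two] at havg
  push_cast [Nat.cast_sub hq2.le] at havg
  have hqR : (1 : ℝ) < Fintype.card F := by exact_mod_cast hq
  generalize (Fintype.card F : ℝ) = Q at havg hsum hqR ⊢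
  have hK : 0 < Q * (Q ^ 2 - 1) := by nlinarith
  rw [inv_mul_le_iff₀ hK] at havg
  have h1 := hsum.trans havg
  have h2 : Q * (Q ^ 2 - 1) * (1 + 2 * (Fintype.card κ : ℝ) ^ 2 / (Q ^ 2 - 1)) =
      Q * (Q - 1) * ((Q + 1) * (1 + 2 * (Fintype.card κ : ℝ) ^ 2 / (Q ^ 2 - 1))) := by ring
  rw [h2] at h1
  exact le_of_mul_le_mul_left h1 (by nlinarith)

end BlockBound

section UniformRatio

open Matrix.SpecialLinearGroup

variable {F : Type*} [Field F] [Fintype F]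
  {κ : Type*} [Fintype κ] [DecidableEq κ]

theorem norm_trace_sq_le_of_elation {ι : Type*} [Fintype ι] [DecidableEq ι]
    (hι : 3 ≤ Fintype.card ι) {σ : SpecialLinearGroup ι F →* Matrix κ κ ℂ}
    (hσ : ∀ g, (σ g)ᴴ = σ g⁻¹) {c ε : ℝ} (hc0 : 0 ≤ c) (hc1 : c ≤ 1)
    (hc : ∀ (v f : ι → F) (h : f ⬝ᵥ v = 0), v ≠ 0 → f ≠ 0 →
      ‖(σ (elation v f h)).trace‖ ≤ c * Fintype.card κ)
    (hε0 : 0 ≤ ε) (hε1 : ε ≤ 1) (hε : c + (1 - c) / Fintype.card F ≤ ε ^ 2)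
    {g : SpecialLinearGroup ι F} (hg : g ∉ Subgroup.center (SpecialLinearGroup ι F)) :
    ‖(σ g).trace‖ ^ 2 ≤ (ε + (1 - ε) / Fintype.card F) * (Fintype.card κ : ℝ) ^ 2 := by
  refine norm_trace_sq_le_of_notMem_center hσ hι hε1 (fun x hx ⟨v, hv, hxv⟩ => ?_) hg
  refine (sq_le_sq₀ (norm_nonneg _) (by positivity)).1 ?_
  rw [mul_pow]
  exact (norm_trace_sq_le_of_mulVec_eq hσ hc0 hc1 hc hx hv hxv).trans (by gcongr)

variable {m : Type*} [Fintype m] [DecidableEq m] [Nonempty m]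
  {σ : SpecialLinearGroup (Fin 2 ⊕ m) F →* Matrix κ κ ℂ}

theorem exists_norm_trace_sq_le [Fintype (SpecialLinearGroup (Fin 2 ⊕ m) F)]
    (hσ : ∀ g, (σ g)ᴴ = σ g⁻¹)
    (hnorm : ∑ g, ‖(σ g).trace‖ ^ 2 = Fintype.card (SpecialLinearGroup (Fin 2 ⊕ m) F))
    (hne : ∃ g, (σ g).trace ≠ 1) :
    ∃ δ : ℝ, 0 ≤ δ ∧ δ ^ 976 * (Fintype.card F : ℝ) ^ 9 ≤ 1 ∧
      ∀ g ∉ Subgroup.center (SpecialLinearGroup (Fin 2 ⊕ m) F),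
        ‖(σ g).trace‖ ^ 2 ≤ δ * (Fintype.card κ : ℝ) ^ 2 := by
  have hι : 3 ≤ Fintype.card (Fin 2 ⊕ m) := by
    rw [Fintype.card_sum, Fintype.card_fin]
    have := Fintype.card_pos (α := m)
    omega
  have hnt : Nontrivial (Fin 2 ⊕ m) := ⟨Sum.inl 0, Sum.inl 1, by simp⟩
  have hd := card_sub_one_le_two_mul_card σ (exists_ne_one_of_trace_ne_one hnorm hne)
  have hq2 : (2 : ℝ) ≤ Fintype.card F := by exact_mod_cast Fintype.one_lt_card (α := F)
  by_cases hq : Fintype.card F ≤ 512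
  · have hq' : (Fintype.card F : ℝ) ≤ 512 := by exact_mod_cast hq
    refine ⟨15 / 16, by norm_num, ?_, fun g hg => ?_⟩
    · calc (15 / 16 : ℝ) ^ 976 * (Fintype.card F : ℝ) ^ 9 ≤ (15 / 16) ^ 968 * 512 ^ 9 := by
            gcongr ?_ * ?_ ^ 9
            exact pow_le_pow_of_le_one (by norm_num) (by norm_num) (by norm_num)
        _ = ((15 / 16) ^ 11) ^ 88 * 512 ^ 9 := by rw [← pow_mul]
        _ ≤ (1 / 2) ^ 88 * 512 ^ 9 := by
            gcongr
            norm_num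
        _ ≤ 1 := by norm_num
    · refine (norm_trace_sq_le_of_elation hι hσ (c := 1 / 2) (ε := 7 / 8) (by norm_num)
        (by norm_num) (fun v f h hv hf => ?_) (by norm_num) (by norm_num) ?_ hg).trans ?_
      · have := two_mul_norm_trace_elation_le hι hσ hnorm hne h hv hf
        linarith
      · have : (1 - 1 / 2 : ℝ) / Fintype.card F ≤ (1 - 1 / 2) / 2 := by gcongr
        linarith
      · have : (1 - 7 / 8 : ℝ) / Fintype.card F ≤ (1 - 7 / 8) / 2 := by gcongr
        gcongr
        linarith
  · have hq' : (512 : ℝ) ≤ Fintype.card F := by exact_mod_cast (not_le.1 hq).le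
    have hel (v f : Fin 2 ⊕ m → F) (h : f ⬝ᵥ v = 0) (hv : v ≠ 0) (hf : f ≠ 0) :
        ‖(σ (elation v f h)).trace‖ ^ 2 * Fintype.card F ≤ 9 * (Fintype.card κ : ℝ) ^ 2 := by
      have h1 := norm_trace_elation_sq_le hσ hnorm h hv hf
      generalize (Fintype.card F : ℝ) = q at *
      generalize (Fintype.card κ : ℝ) = d at *
      have hs : (0 : ℝ) < q ^ 2 - 1 := by nlinarith
      have hq1 : 0 < q - 1 := by linarith
      have h2 : (q + 1) * (1 + 2 * d ^ 2 / (q ^ 2 - 1)) = (q + 1) + 2 * d ^ 2 / (q - 1) := by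
        have : q ^ 2 - 1 = (q + 1) * (q - 1) := by ring
        rw [this]
        have : q + 1 ≠ 0 := by linarith
        field_simp
      have h3 : (q - 1) ^ 2 ≤ 4 * d ^ 2 := by nlinarith
      rw [h2, ← sub_le_iff_le_add', le_div_iff₀ hq1] at h1
      generalize ‖(σ (elation v f h)).trace‖ ^ 2 = t at *
      nlinarith
    obtain ⟨s, hs0, hs, hs4⟩ : ∃ s : ℝ, 0 ≤ s ∧ s ≤ 10 / 47 ∧ s ^ 4 * Fintype.card F = 1 := by
      refine ⟨(√√(Fintype.card F))⁻¹, by positivity, ?_, ?_⟩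
      · rw [inv_le_comm₀ (by positivity) (by norm_num)]
        refine Real.le_sqrt_of_sq_le (Real.le_sqrt_of_sq_le ?_)
        norm_num
        linarith
      · rw [show 4 = 2 * 2 from rfl, pow_mul, inv_pow, Real.sq_sqrt (Real.sqrt_nonneg _),
          inv_pow, Real.sq_sqrt (by positivity), inv_mul_cancel₀ (by positivity)]
    have hdiv (x : ℝ) : x / Fintype.card F = x * s ^ 4 := by
      rw [div_eq_iff (by positivity), mul_assoc, hs4, mul_one]
    have hs2 : s ^ 2 ≤ (10 / 47) ^ 2 := by gcongr
    have hs3 : s ^ 3 ≤ (10 / 47) ^ 3 := by gcongr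
    refine ⟨2 * s + s ^ 4, by positivity, ?_, fun g hg => ?_⟩
    · have h1 : (2 * s + s ^ 4) ^ 2 ≤ s := by
        calc (2 * s + s ^ 4) ^ 2 = s * (s * (2 + s ^ 3) ^ 2) := by ring
          _ ≤ s * (10 / 47 * (2 + (10 / 47) ^ 3) ^ 2) := by gcongr
          _ ≤ s * 1 := by
              gcongr
              norm_num
          _ = s := mul_one s
      calc (2 * s + s ^ 4) ^ 976 * (Fintype.card F : ℝ) ^ 9
          = ((2 * s + s ^ 4) ^ 2) ^ 488 * (Fintype.card F : ℝ) ^ 9 := by rw [← pow_mul]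
        _ ≤ s ^ 488 * (Fintype.card F : ℝ) ^ 9 := by gcongr
        _ = s ^ 452 * (s ^ 4 * (Fintype.card F : ℝ)) ^ 9 := by
            rw [mul_pow, ← pow_mul, ← mul_assoc, ← pow_add]
        _ ≤ 1 := by
            rw [hs4, one_pow, mul_one]
            exact pow_le_one₀ hs0 (by linarith)
    · refine (norm_trace_sq_le_of_elation hι hσ (c := 3 * s ^ 2) (ε := 2 * s) (by positivity)
        (by linarith) (fun v f h hv hf => ?_) (by positivity) (by linarith) ?_ hg).trans ?_
      · refine (sq_le_sq₀ (norm_nonneg _) (by positivity)).1 ?_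
        have := mul_le_mul_of_nonneg_left (hel v f h hv hf) (pow_nonneg hs0 4)
        linear_combination this + ‖(σ (elation v f h)).trace‖ ^ 2 * (-hs4)
      · rw [hdiv]
        have h1 : 0 ≤ s ^ 6 := by positivity
        have h2 : s ^ 4 = s ^ 2 * s ^ 2 := by ring
        nlinarith [sq_nonneg s]
      · rw [hdiv]
        have h1 : 0 ≤ s ^ 5 := by positivity
        gcongr
        linarith

end UniformRatio

section Lifting

theorem IsIrrChar.exists_unitary_hom_comp {G : Type} [Group G] [Finite G] {H : Type*} [Group H]
    [Fintype H] {π : H →* G} (hπ : Function.Surjective π) {α : G → ℂ} (hα : IsIrrChar G α)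
    (hne : α ≠ fun _ => 1) : ∃ (d : ℕ) (σ : H →* Matrix (Fin d) (Fin d) ℂ),
      (∀ g, (σ g)ᴴ = σ g⁻¹) ∧ (∀ g, (σ g).trace = α (π g)) ∧
        ∑ g, ‖(σ g).trace‖ ^ 2 = Fintype.card H ∧ ∃ g, (σ g).trace ≠ 1 := by
  have := Fintype.ofFinite G
  obtain ⟨d, σ, hσ, htr, -⟩ := hα.exists_unitary_hom
  refine ⟨d, σ.comp π, fun g => ?_, fun g => htr (π g), ?_, ?_⟩
  · rw [MonoidHom.comp_apply, hσ, MonoidHom.comp_apply, map_inv π]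
  · have h := sum_comp_of_surjective π hπ fun g => ‖α g‖ ^ 2
    rw [hα.sum_norm_sq, mul_comm] at h
    simp only [MonoidHom.comp_apply, htr]
    exact mul_right_cancel₀ (Nat.cast_ne_zero.2 Fintype.card_ne_zero) h
  · obtain ⟨g, hg⟩ := Function.ne_iff.1 hne
    obtain ⟨h, rfl⟩ := hπ g
    exact ⟨h, by rwa [MonoidHom.comp_apply, htr]⟩

theorem mcKayDiamLE_of_norm_sq_le {G : Type} [Group G] [Finite G] {α : G → ℂ}
    (hα : IsIrrChar G α) {δ : ℝ} (hδ0 : 0 ≤ δ) (hδ : ∀ g ≠ 1, ‖α g‖ ^ 2 ≤ δ * ‖α 1‖ ^ 2)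
    {k D : ℕ} (hk : δ ^ k * Nat.card G < 1) (hD : 2 * k ≤ D) : McKayDiamLE G α D := by
  intro χ₁ χ₂ h₁ h₂
  have := Fintype.ofFinite G
  obtain ⟨d, hd, hd1⟩ := hα.exists_apply_one_eq
  refine ⟨2 * k, hD, charInner_pow_mul_ne_zero (ε := √δ) ?_ h₁ h₂ (fun g hg => ?_)
    (Real.sqrt_nonneg δ) ?_⟩
  · rw [hd1]
    exact_mod_cast hd.ne'
  · refine (sq_le_sq₀ (norm_nonneg _) (by positivity)).1 ?_
    rw [mul_pow, Real.sq_sqrt hδ0]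
    exact hδ g hg
  · rwa [pow_mul, Real.sq_sqrt hδ0, ← Nat.card_eq_fintype_card]

variable {ι F : Type*} [Fintype ι] [DecidableEq ι] [Field F]

theorem card_specialLinearGroup_lt [Fintype F] [Nonempty ι] :
    Nat.card (SpecialLinearGroup ι F) < Fintype.card F ^ Fintype.card ι ^ 2 := by
  classical
  rw [Nat.card_eq_fintype_card]
  refine (Fintype.card_lt_of_injective_of_notMem (Subtype.val : SpecialLinearGroup ι F → _)
    Subtype.val_injective (b := 0) ?_).trans_eq ?_
  · rintro ⟨g, hg⟩
    have := g.2
    rw [hg, det_zero] at this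
    exact zero_ne_one this
  · rw [← Fintype.card_congr (Matrix.of (m := ι) (n := ι) (α := F)), Fintype.card_fun,
      Fintype.card_fun, ← pow_mul, sq]

/-- Reindexing rows and columns of matrices of determinant one. -/
def reindexSL {ι' : Type*} [Fintype ι'] [DecidableEq ι'] (e : ι ≃ ι') :
    SpecialLinearGroup ι F ≃* SpecialLinearGroup ι' F where
  toFun g := ⟨reindex e e g.1, by rw [det_reindex_self, g.2]⟩
  invFun g := ⟨reindex e.symm e.symm g.1, by rw [det_reindex_self, g.2]⟩
  left_inv g := Subtype.ext (by simp)
  right_inv g := Subtype.ext (by simp)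
  map_mul' g h := Subtype.ext ((submatrix_mul_equiv _ _ _ _ _).symm)

theorem MulEquiv.apply_mem_center_iff {G H : Type*} [Group G] [Group H] (e : G ≃* H) {g : G} :
    e g ∈ Subgroup.center H ↔ g ∈ Subgroup.center G := by
  simp only [Subgroup.mem_center_iff, e.surjective.forall, ← map_mul, e.injective.eq_iff]

theorem mcKayDiamLE_of_three_le {n : ℕ} (hn : 3 ≤ n) {F : Type} [Field F] [Fintype F]
    {α : PSL(n, F) → ℂ} (hα : IsIrrChar PSL(n, F) α) (hne : α ≠ fun _ => 1) :
    McKayDiamLE PSL(n, F) α (489 * (n - 1) ^ 2) := by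
  classical
  have : Nonempty (Fin (n - 2)) := ⟨⟨0, by omega⟩⟩
  have : Nonempty (Fin n) := ⟨⟨0, by omega⟩⟩
  let e : Fin 2 ⊕ Fin (n - 2) ≃ Fin n := finSumFinEquiv.trans (finCongr (by omega))
  let π : SpecialLinearGroup (Fin 2 ⊕ Fin (n - 2)) F →* PSL(n, F) :=
    (QuotientGroup.mk' _).comp (reindexSL e).toMonoidHom
  have hπ : Function.Surjective π :=
    (QuotientGroup.mk'_surjective _).comp (reindexSL e).surjective
  have hker (g) : π g = 1 ↔ g ∈ Subgroup.center _ :=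
    (QuotientGroup.eq_one_iff _).trans (MulEquiv.apply_mem_center_iff _)
  have : Finite PSL(n, F) := Finite.of_surjective π hπ
  obtain ⟨d, σ, hσ, htr, hnorm, hne'⟩ := hα.exists_unitary_hom_comp hπ hne
  obtain ⟨δ, hδ0, hδq, hδ⟩ := exists_norm_trace_sq_le hσ hnorm hne'
  have hα1 : α 1 = d := by rw [← map_one π, ← htr, map_one, trace_one, Fintype.card_fin]
  refine mcKayDiamLE_of_norm_sq_le hα hδ0 (fun g hg => ?_) (k := 244 * (n - 1) ^ 2) ?_
    (by nlinarith)
  · obtain ⟨h, rfl⟩ := hπ g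
    rw [← htr, hα1, Complex.norm_natCast]
    simpa using hδ h fun hc => hg ((hker h).2 hc)
  · have hcard : Nat.card PSL(n, F) < Fintype.card F ^ n ^ 2 := by
      refine (Nat.card_le_card_of_surjective _ (QuotientGroup.mk'_surjective _)).trans_lt ?_
      simpa using card_specialLinearGroup_lt (ι := Fin n) (F := F)
    have hq : (1 : ℝ) ≤ Fintype.card F := by exact_mod_cast Fintype.card_pos
    have hn2 : n ^ 2 * 4 ≤ 9 * (n - 1) ^ 2 := by
      obtain ⟨k, rfl⟩ := Nat.exists_eq_add_of_le hn
      rw [show 3 + k - 1 = k + 2 by omega]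
      nlinarith
    have hle : δ ^ (244 * (n - 1) ^ 2) * (Fintype.card F : ℝ) ^ n ^ 2 ≤ 1 := by
      refine (pow_le_one_iff_of_nonneg (by positivity) four_ne_zero).1 ?_
      calc _ = (δ ^ 976) ^ (n - 1) ^ 2 * (Fintype.card F : ℝ) ^ (n ^ 2 * 4) := by
            rw [mul_pow, ← pow_mul, ← pow_mul, ← pow_mul]
            congr 2
            ring
        _ ≤ (δ ^ 976) ^ (n - 1) ^ 2 * (Fintype.card F : ℝ) ^ (9 * (n - 1) ^ 2) := by gcongr
        _ = (δ ^ 976 * (Fintype.card F : ℝ) ^ 9) ^ (n - 1) ^ 2 := by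
            rw [mul_pow, ← pow_mul (Fintype.card F : ℝ)]
        _ ≤ 1 := pow_le_one₀ (by positivity) hδq
    rcases (pow_nonneg hδ0 (244 * (n - 1) ^ 2)).eq_or_lt with h0 | h0
    · rw [← h0, zero_mul]
      exact one_pos
    · refine (mul_lt_mul_of_pos_left ?_ h0).trans_le hle
      exact_mod_cast hcard

end Lifting

section RankOne

variable {F : Type*} [Field F]

theorem SL_two_det_eq (k : SL(2, F)) : k.1 0 0 * k.1 1 1 - k.1 0 1 * k.1 1 0 = 1 := by
  rw [← Matrix.det_fin_two]
  exact k.2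

theorem SL_two_mem_center_of_apply_eq {g : SL(2, F)} (h01 : g.1 0 1 = 0) (h10 : g.1 1 0 = 0)
    (h : g.1 0 0 = g.1 1 1) : g ∈ Subgroup.center SL(2, F) := by
  refine Matrix.SpecialLinearGroup.mem_center_iff.2 ⟨g.1 0 0, ?_, ?_⟩
  · have hdet := SL_two_det_eq g
    rw [h01, zero_mul, sub_zero, ← h] at hdet
    rw [Fintype.card_fin, sq, hdet]
  · ext i j
    fin_cases i <;> fin_cases j <;> simp [h01, h10, h]

theorem SL_two_ext {x y : SL(2, F)} (h00 : x.1 0 0 = y.1 0 0) (h01 : x.1 0 1 = y.1 0 1)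
    (h10 : x.1 1 0 = y.1 1 0) (h11 : x.1 1 1 = y.1 1 1) : x = y := by
  ext i j
  fin_cases i <;> fin_cases j <;> assumption

theorem SL_two_eq_or_of_apply_eq {x z : SL(2, F)} (h01 : x.1 0 1 = z.1 0 1)
    (h10 : x.1 1 0 = z.1 1 0) (h : x.1 0 0 - x.1 1 1 = z.1 0 0 - z.1 1 1) :
    x = z ∨ x.1 1 1 = -z.1 0 0 := by
  have hx := SL_two_det_eq x
  have hz := SL_two_det_eq z
  rw [h01, h10] at hx
  have h0 : (x.1 1 1 - z.1 1 1) * (x.1 1 1 + z.1 0 0) = 0 := by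
    linear_combination hx - hz - x.1 1 1 * h
  rcases mul_eq_zero.1 h0 with h1 | h1
  · refine Or.inl (SL_two_ext ?_ h01 h10 ?_)
    · linear_combination h + h1
    · linear_combination h1
  · exact Or.inr (by linear_combination h1)

theorem card_commute_le [Fintype F] [DecidableEq F] {g : SL(2, F)}
    (hg : g ∉ Subgroup.center SL(2, F)) :
    (Finset.univ.filter fun x => x * g = g * x).card ≤ 2 * Fintype.card F := by
  have hmul (x : SL(2, F)) (hx : x * g = g * x) :
      x.1 0 1 * g.1 1 0 = g.1 0 1 * x.1 1 0 ∧
      x.1 0 0 * g.1 0 1 + x.1 0 1 * g.1 1 1 = g.1 0 0 * x.1 0 1 + g.1 0 1 * x.1 1 1 ∧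
      x.1 1 0 * g.1 0 0 + x.1 1 1 * g.1 1 0 = g.1 1 0 * x.1 0 0 + g.1 1 1 * x.1 1 0 := by
    have h : x.1 * g.1 = g.1 * x.1 := congrArg Subtype.val hx
    have h00 := congrFun (congrFun h 0) 0
    have h01 := congrFun (congrFun h 0) 1
    have h10 := congrFun (congrFun h 1) 0
    simp only [mul_apply, Fin.sum_univ_two] at h00 h01 h10
    exact ⟨by linear_combination h00, h01, h10⟩
  have key {x y z : SL(2, F)} (hxz01 : x.1 0 1 = z.1 0 1) (hxz10 : x.1 1 0 = z.1 1 0)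
      (hxz : x.1 0 0 - x.1 1 1 = z.1 0 0 - z.1 1 1) (hxy01 : x.1 0 1 = y.1 0 1)
      (hxy10 : x.1 1 0 = y.1 1 0) (hxy : x.1 0 0 - x.1 1 1 = y.1 0 0 - y.1 1 1)
      (h1 : x ≠ y) (h2 : x ≠ z) : y = z := by
    have h3 := (SL_two_eq_or_of_apply_eq hxy01 hxy10 hxy).resolve_left h1
    have h4 := (SL_two_eq_or_of_apply_eq hxz01 hxz10 hxz).resolve_left h2
    refine SL_two_ext ?_ (hxy01.symm.trans hxz01) (hxy10.symm.trans hxz10) ?_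
    · linear_combination h3 - h4
    · linear_combination hxy - hxz + h3 - h4
  suffices h : ∃ f : SL(2, F) → F, ∀ x y z : SL(2, F), x * g = g * x → y * g = g * y →
      z * g = g * z → f x = f z → f y = f z → x ≠ y → x ≠ z → y = z by
    obtain ⟨f, hf⟩ := h
    rw [← Finset.card_univ]
    refine Finset.card_le_mul_card_image_of_maps_to (f := f) (fun _ _ => Finset.mem_univ _) 2
      fun b _ => ?_
    by_contra! hlt
    obtain ⟨x, hx, y, hy, z, hz, hxy, hxz, hyz⟩ := Finset.two_lt_card.1 hlt
    simp only [Finset.mem_filter, Finset.mem_univ, true_and] at hx hy hz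
    exact hyz (hf x y z hx.1 hy.1 hz.1 (hx.2.trans hz.2.symm) (hy.2.trans hz.2.symm) hxy hxz)
  by_cases hb : g.1 0 1 = 0
  · by_cases hc : g.1 1 0 = 0
    · refine ⟨fun x => x.1 0 0, fun x y z hx hy hz hxz hyz h1 h2 => ?_⟩
      have had : g.1 0 0 ≠ g.1 1 1 := fun h => hg (SL_two_mem_center_of_apply_eq hb hc h)
      have := hmul x hx
      have := hmul y hy
      have := hmul z hz
      have := SL_two_det_eq x
      have := SL_two_det_eq y
      have := SL_two_det_eq z
      apply SL_two_ext <;> grind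
    · refine ⟨fun x => x.1 1 0, fun x y z hx hy hz hxz hyz => ?_⟩
      have aux (w : SL(2, F)) (hw : w * g = g * w) (h : x.1 1 0 = w.1 1 0) :
          x.1 0 1 = w.1 0 1 ∧ x.1 0 0 - x.1 1 1 = w.1 0 0 - w.1 1 1 := by
        obtain ⟨h1, -, h3⟩ := hmul x hx
        obtain ⟨h1', -, h3'⟩ := hmul w hw
        constructor <;> refine mul_left_cancel₀ hc ?_
        · linear_combination h1 - h1' + g.1 0 1 * h
        · linear_combination h3' - h3 + (g.1 0 0 - g.1 1 1) * h
      obtain ⟨hz1, hz2⟩ := aux z hz hxz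
      obtain ⟨hy1, hy2⟩ := aux y hy (hxz.trans hyz.symm)
      exact key hz1 hxz hz2 hy1 (hxz.trans hyz.symm) hy2
  · refine ⟨fun x => x.1 0 1, fun x y z hx hy hz hxz hyz => ?_⟩
    have aux (w : SL(2, F)) (hw : w * g = g * w) (h : x.1 0 1 = w.1 0 1) :
        x.1 1 0 = w.1 1 0 ∧ x.1 0 0 - x.1 1 1 = w.1 0 0 - w.1 1 1 := by
      obtain ⟨h1, h3, -⟩ := hmul x hx
      obtain ⟨h1', h3', -⟩ := hmul w hw
      constructor <;> refine mul_left_cancel₀ hb ?_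
      · linear_combination h1' - h1 + g.1 1 0 * h
      · linear_combination h3 - h3' + (g.1 0 0 - g.1 1 1) * h
    obtain ⟨hz1, hz2⟩ := aux z hz hxz
    obtain ⟨hy1, hy2⟩ := aux y hy (hxz.trans hyz.symm)
    exact key hxz hz1 hz2 (hxz.trans hyz.symm) hy1 hy2

theorem card_conj_eq_le {G : Type*} [Group G] [Fintype G] [DecidableEq G] (g y : G) :
    (Finset.univ.filter fun x => x * g * x⁻¹ = y).card ≤
      (Finset.univ.filter fun x => x * g = g * x).card := by
  rcases (Finset.univ.filter fun x => x * g * x⁻¹ = y).eq_empty_or_nonempty with h | ⟨x₀, h₀⟩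
  · simp [h]
  · replace h₀ := (Finset.mem_filter.1 h₀).2
    refine Finset.card_le_card_of_injOn (fun x => x₀⁻¹ * x) (fun x hx => ?_)
      (mul_right_injective x₀⁻¹).injOn
    replace hx := (Finset.mem_filter.1 hx).2
    refine Finset.mem_filter.2 ⟨Finset.mem_univ _, ?_⟩
    rw [← h₀, mul_inv_eq_iff_eq_mul] at hx
    change x₀⁻¹ * x * g = g * (x₀⁻¹ * x)
    rw [mul_assoc, hx]
    group

theorem card_mul_norm_sq_trace_le {G κ : Type*} [Group G] [Fintype G] [DecidableEq G]
    [Fintype κ] [DecidableEq κ] (σ : G →* Matrix κ κ ℂ) (g : G) :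
    Fintype.card G * ‖(σ g).trace‖ ^ 2 ≤
      (Finset.univ.filter fun x => x * g = g * x).card * ∑ y, ‖(σ y).trace‖ ^ 2 := by
  calc (Fintype.card G : ℝ) * ‖(σ g).trace‖ ^ 2
      = ∑ x : G, ‖(σ (x * g * x⁻¹)).trace‖ ^ 2 := by
        simp only [trace_conj_eq, Finset.sum_const, Finset.card_univ, nsmul_eq_mul]
    _ = ∑ y : G, ∑ x with x * g * x⁻¹ = y, ‖(σ (x * g * x⁻¹)).trace‖ ^ 2 :=
        (Finset.sum_fiberwise _ _ _).symm
    _ = ∑ y : G, (Finset.univ.filter fun x => x * g * x⁻¹ = y).card * ‖(σ y).trace‖ ^ 2 := by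
        refine Finset.sum_congr rfl fun y _ => ?_
        rw [← nsmul_eq_mul, ← Finset.sum_const]
        exact Finset.sum_congr rfl fun x hx => by rw [(Finset.mem_filter.1 hx).2]
    _ ≤ _ := by
        rw [Finset.mul_sum]
        exact Finset.sum_le_sum fun y _ => mul_le_mul_of_nonneg_right
          (Nat.cast_le.2 (card_conj_eq_le g y)) (sq_nonneg _)

theorem card_le_card_mul_card_class {G : Type*} [Group G] [Fintype G] [DecidableEq G] {E : Type*}
    [DecidableEq E] {f : G → E} (hf : ∀ g x, f (x * g * x⁻¹) = f g) (g : G) :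
    Fintype.card G ≤ (Finset.univ.filter fun x => x * g = g * x).card *
      (Finset.univ.filter fun y => f y = f g).card := by
  rw [← Finset.card_univ]
  exact Finset.card_le_mul_card_image_of_maps_to (f := fun x => x * g * x⁻¹)
    (fun x _ => Finset.mem_filter.2 ⟨Finset.mem_univ _, hf g x⟩) _
    fun y _ => card_conj_eq_le g y

theorem card_image_le_of_card_commute_le {G : Type*} [Group G] [Fintype G] [DecidableEq G]
    {E : Type*} [DecidableEq E] {f : G → E} (hf : ∀ g x, f (x * g * x⁻¹) = f g) {T : Finset G}
    {m : ℕ} (hm : ∀ g ∈ T, (Finset.univ.filter fun x => x * g = g * x).card ≤ m) :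
    (T.image f).card ≤ m := by
  refine Nat.le_of_mul_le_mul_right (c := Fintype.card G) ?_ Fintype.card_pos
  calc (T.image f).card * Fintype.card G = ∑ v ∈ T.image f, Fintype.card G := by simp
    _ ≤ ∑ v ∈ T.image f, m * (Finset.univ.filter fun y => f y = v).card := by
        refine Finset.sum_le_sum fun v hv => ?_
        obtain ⟨g, hg, rfl⟩ := Finset.mem_image.1 hv
        exact (card_le_card_mul_card_class hf g).trans (Nat.mul_le_mul_right _ (hm g hg))
    _ = m * ∑ v ∈ T.image f, (Finset.univ.filter fun y => f y = v).card := by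
        rw [Finset.mul_sum]
    _ ≤ m * Fintype.card G := by
        gcongr
        rw [← Finset.card_biUnion fun v _ w _ hvw => Finset.disjoint_filter.2
          fun y _ h1 h2 => hvw (h1.symm.trans h2)]
        exact Finset.card_le_univ _

end RankOne

section SimpleRankOne

open scoped ComplexOrder in
theorem eq_one_of_trace_eq {G κ : Type*} [Group G] [Fintype κ] [DecidableEq κ]
    {σ : G →* Matrix κ κ ℂ} (hσ : ∀ g, (σ g)ᴴ = σ g⁻¹) {g : G}
    (h : (σ g).trace = (σ 1).trace) : σ g = 1 := by
  refine sub_eq_zero.1 (trace_conjTranspose_mul_self_eq_zero_iff.1 ?_)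
  have h' : (σ g⁻¹).trace = (σ 1).trace := by
    rw [← hσ, trace_conjTranspose, h, ← trace_conjTranspose, hσ, inv_one]
  rw [conjTranspose_sub, conjTranspose_one, sub_mul, mul_sub, mul_sub, hσ, ← map_mul,
    inv_mul_cancel, mul_one, one_mul, one_mul, trace_sub, trace_sub, trace_sub, h, h', map_one]
  ring

theorem IsIrrChar.apply_ne_apply_one {G : Type} [Group G] [Fintype G] [IsSimpleGroup G]
    {α : G → ℂ} (hα : IsIrrChar G α) (hne : α ≠ fun _ => 1) {g : G} (hg : g ≠ 1) :
    α g ≠ α 1 := by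
  obtain ⟨d, σ, hσ, htr, hnorm⟩ := hα.exists_unitary_hom
  intro h
  rw [← htr, ← htr] at h
  have hker : g ∈ σ.ker := eq_one_of_trace_eq hσ h
  rcases IsSimpleGroup.eq_bot_or_eq_top_of_normal σ.ker inferInstance with hbot | htop
  · rw [hbot] at hker
    exact hg (Subgroup.mem_bot.1 hker)
  · obtain ⟨x, hx⟩ := Function.ne_iff.1 hne
    obtain ⟨y, hy⟩ := exists_ne_one_of_trace_ne_one hnorm ⟨x, by rwa [htr]⟩
    exact hy (htop ▸ Subgroup.mem_top y : y ∈ σ.ker)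

theorem IsIrrChar.apply_conj {G : Type} [Group G] [Finite G] {α : G → ℂ} (hα : IsIrrChar G α)
    (g x : G) : α (x * g * x⁻¹) = α g := by
  have := Fintype.ofFinite G
  obtain ⟨d, σ, -, htr, -⟩ := hα.exists_unitary_hom
  rw [← htr, ← htr, trace_conj_eq]

variable {F : Type} [Field F] [Fintype F] {α : PSL(2, F) → ℂ}

theorem PSL_two_card_image_le [DecidableEq F] [Fintype PSL(2, F)] (hα : IsIrrChar PSL(2, F) α) :
    ((Finset.univ.filter fun g => g ≠ 1).image α).card ≤ 2 * Fintype.card F := by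
  classical
  let π := QuotientGroup.mk' (Subgroup.center SL(2, F))
  have h := card_image_le_of_card_commute_le (f := fun g => α (π g))
    (fun g x => by simp only [map_mul, map_inv, hα.apply_conj])
    (T := Finset.univ.filter fun g => g ∉ Subgroup.center SL(2, F))
    (fun g hg => card_commute_le (Finset.mem_filter.1 hg).2)
  refine (Finset.card_le_card fun v hv => ?_).trans h
  obtain ⟨g, hg, rfl⟩ := Finset.mem_image.1 hv
  obtain ⟨x, rfl⟩ := QuotientGroup.mk'_surjective _ g
  refine Finset.mem_image.2 ⟨x, Finset.mem_filter.2 ⟨Finset.mem_univ _, fun hx => ?_⟩, rfl⟩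
  exact (Finset.mem_filter.1 hg).2 ((QuotientGroup.eq_one_iff x).2 hx)

theorem PSL_two_norm_sq_le (hα : IsIrrChar PSL(2, F) α) (hne : α ≠ fun _ => 1) {g : PSL(2, F)}
    (hg : g ≠ 1) : ‖α g‖ ^ 2 ≤ 2 * Fintype.card F := by
  classical
  obtain ⟨d, σ, hσ, htr, hnorm, -⟩ := hα.exists_unitary_hom_comp
    (QuotientGroup.mk'_surjective (Subgroup.center SL(2, F))) hne
  obtain ⟨x, rfl⟩ := QuotientGroup.mk'_surjective _ g
  have hx : x ∉ Subgroup.center SL(2, F) := fun hx => hg ((QuotientGroup.eq_one_iff x).2 hx)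
  have h := card_mul_norm_sq_trace_le σ x
  rw [hnorm, htr, mul_comm] at h
  refine (le_of_mul_le_mul_right h (Nat.cast_pos.2 Fintype.card_pos)).trans ?_
  exact_mod_cast card_commute_le hx

theorem PSL_two_card_sub_one_le (hα : IsIrrChar PSL(2, F) α) (hne : α ≠ fun _ => 1) :
    (Fintype.card F : ℝ) - 1 ≤ 2 * ‖α 1‖ := by
  classical
  obtain ⟨d, σ, hσ, htr, hnorm, htr1⟩ := hα.exists_unitary_hom_comp
    (QuotientGroup.mk'_surjective (Subgroup.center SL(2, F))) hne
  have h := card_sub_one_le_two_mul_card σ (exists_ne_one_of_trace_ne_one hnorm htr1)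
  have h1 := htr 1
  rw [map_one, map_one, trace_one] at h1
  rwa [← h1, Complex.norm_natCast]

theorem mcKayDiamLE_PSL_two [IsSimpleGroup PSL(2, F)] (hα : IsIrrChar PSL(2, F) α)
    (hne : α ≠ fun _ => 1) : McKayDiamLE PSL(2, F) α 489 := by
  classical
  have := Fintype.ofFinite PSL(2, F)
  rcases le_or_gt (Fintype.card F) 244 with hq | hq
  · intro χ₁ χ₂ h₁ h₂
    obtain ⟨j, hj, h⟩ := exists_charInner_pow_mul_ne_zero h₁ h₂
      ((Finset.univ.filter fun g => g ≠ 1).image α)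
      (fun g hg => Finset.mem_image_of_mem α (Finset.mem_filter.2 ⟨Finset.mem_univ g, hg⟩))
      (fun h => by
        obtain ⟨g, hg, h⟩ := Finset.mem_image.1 h
        exact hα.apply_ne_apply_one hne (Finset.mem_filter.1 hg).2 h)
    have := PSL_two_card_image_le hα
    exact ⟨j, by omega, h⟩
  · have hq' : (245 : ℝ) ≤ Fintype.card F := by exact_mod_cast hq
    have hd := PSL_two_card_sub_one_le hα hne
    set q := (Fintype.card F : ℝ)
    have hq0 : 0 < q := by linarith
    refine mcKayDiamLE_of_norm_sq_le hα (δ := 9 / q) (by positivity) (fun g hg => ?_) (k := 244)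
      ?_ (by norm_num)
    · refine (PSL_two_norm_sq_le hα hne hg).trans ?_
      rw [div_mul_eq_mul_div, le_div_iff₀ hq0]
      have h2 : (q - 1) ^ 2 ≤ (2 * ‖α 1‖) ^ 2 := pow_le_pow_left₀ (by linarith) hd 2
      nlinarith
    · have hcard : (Nat.card PSL(2, F) : ℝ) < q ^ 4 := by
        have h1 : Nat.card PSL(2, F) ≤ Nat.card SL(2, F) :=
          Nat.card_le_card_of_surjective _ (QuotientGroup.mk'_surjective _)
        have h2 := card_specialLinearGroup_lt (ι := Fin 2) (F := F)
        norm_num only [Fintype.card_fin] at h2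
        have h3 := Nat.cast_lt (α := ℝ).2 (h1.trans_lt h2)
        rwa [Nat.cast_pow] at h3
      have hδ : (9 / q) ^ 244 ≤ 1 / q ^ 4 := by
        calc (9 / q) ^ 244 ≤ (9 / q) ^ 8 :=
              pow_le_pow_of_le_one (by positivity) ((div_le_one hq0).2 (by linarith)) (by norm_num)
          _ ≤ 1 / q ^ 4 := by
              rw [div_pow, div_le_div_iff₀ (by positivity) (by positivity), one_mul]
              calc (9 : ℝ) ^ 8 * q ^ 4 = 81 ^ 4 * q ^ 4 := by norm_num
                _ ≤ q ^ 4 * q ^ 4 := by gcongr; linarith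
                _ = q ^ 8 := by ring
      calc (9 / q) ^ 244 * (Nat.card PSL(2, F) : ℝ) ≤ 1 / q ^ 4 * Nat.card PSL(2, F) := by gcongr
        _ < 1 / q ^ 4 * q ^ 4 := by gcongr
        _ = 1 := by field_simp

end SimpleRankOne

end

/-- **Theorem 2 (for `PSL_n(q)`).** If `G = PSL_n(q)` is simple (with `q` a prime power,
i.e. `q = |F|` for a finite field `F`), then for every nontrivial irreducible character `α`
of `G`, `diam M(G,α) ≤ 489·(n−1)²`. -/
theorem mckay_diam_le_of_PSL (n : ℕ) (hn : 2 ≤ n) (q : ℕ)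
    (F : Type) [Field F] [Fintype F] (hq : Fintype.card F = q)
    (hsimple : IsSimpleGroup PSL(n, F))
    (α : PSL(n, F) → ℂ) (hα : IsIrrChar PSL(n, F) α) (hnontriv : α ≠ fun _ => 1) :
    McKayDiamLE PSL(n, F) α (489 * (n - 1) ^ 2) := by
  rcases hn.eq_or_lt with rfl | hn
  · exact mcKayDiamLE_PSL_two hα hnontriv
  · exact mcKayDiamLE_of_three_le hn hα hnontriv
end

section
/- Let n ≥ 5 and let G = S_n be the symmetric group on n letters. Then for every faithful irreducible character α of G, diam M(G,α) ≤ 4n−4; that is, for all irreducible characters χ₁, χ₂ of G there exists an integer j with 0 ≤ j ≤ 4n−4 such that [α^j·χ₁, χ₂]_G ≠ 0. -/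
open scoped BigOperators

section ContainsPermRep

open Representation TensorProduct

/-- The class function `χ` is afforded by a finite-dimensional representation containing a linearly
independent family of vectors that is permuted by `G` like the `G`-set `I`; that is, the permutation
representation `ℂ[I]` embeds into a representation affording `χ`. -/
def ContainsPermRep {G : Type} [Group G] (χ : G → ℂ) (I : Type) [MulAction G I] : Prop :=
  ∃ (W : Type) (_ : AddCommGroup W) (_ : Module ℂ W) (_ : FiniteDimensional ℂ W)
    (σ : Representation ℂ G W) (w : I → W),
    σ.character = χ ∧ LinearIndependent ℂ w ∧ ∀ g i, σ g (w i) = w (g • i)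

variable {G : Type} [Group G]

theorem ContainsPermRep.mul {χ ψ : G → ℂ} {I J : Type} [MulAction G I] [MulAction G J]
    (hχ : ContainsPermRep χ I) (hψ : ContainsPermRep ψ J) : ContainsPermRep (χ * ψ) (I × J) := by
  obtain ⟨V, _, _, _, ρ, v, rfl, hv, hρ⟩ := hχ
  obtain ⟨W, _, _, _, σ, w, rfl, hw, hσ⟩ := hψ
  refine ⟨V ⊗[ℂ] W, inferInstance, inferInstance, inferInstance, ρ.tprod σ,
    fun i ↦ v i.1 ⊗ₜ w i.2, char_tensor ρ σ, hv.tmul_of_flat_left hw, fun g i ↦ ?_⟩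
  simp [hρ, hσ]

theorem ContainsPermRep.comp {χ : G → ℂ} {I J : Type} [MulAction G I] [MulAction G J]
    (hχ : ContainsPermRep χ I) (f : J → I) (hf : Function.Injective f)
    (hfg : ∀ (g : G) j, f (g • j) = g • f j) : ContainsPermRep χ J := by
  obtain ⟨V, _, _, _, ρ, v, rfl, hv, hρ⟩ := hχ
  exact ⟨V, _, _, inferInstance, ρ, v ∘ f, rfl, hv.comp f hf, fun g j ↦ by simp [hρ, hfg]⟩

theorem containsPermRep_one_unique {I : Type} [MulAction G I] [Unique I] :
    ContainsPermRep (1 : G → ℂ) I := by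
  refine ⟨ℂ, inferInstance, inferInstance, inferInstance, Representation.trivial ℂ G ℂ,
    fun _ ↦ 1, ?_, ?_, ?_⟩
  · ext g
    simp [character, Representation.trivial]
  · exact .of_subsingleton default one_ne_zero
  · simp

theorem ContainsPermRep.pow {χ : G → ℂ} {I : Type} [MulAction G I] (hχ : ContainsPermRep χ I)
    (k : ℕ) : ContainsPermRep (χ ^ k) (Fin k → I) := by
  induction k with
  | zero => simpa using containsPermRep_one_unique
  | succ k ih =>
    rw [pow_succ']
    exact (hχ.mul ih).comp (Fin.consEquiv fun _ ↦ I).symm (Equiv.injective _) fun g j ↦ rfl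

/-- A representation containing the regular representation has nonzero invariants after tensoring
with any nonzero representation. -/
theorem ContainsPermRep.sum_mul_character_ne_zero [Fintype G] {χ : G → ℂ}
    (hχ : ContainsPermRep χ G) {Y : Type} [AddCommGroup Y] [Module ℂ Y] [FiniteDimensional ℂ Y]
    [Nontrivial Y] (τ : Representation ℂ G Y) : ∑ g, χ g * τ.character g ≠ 0 := by
  classical
  obtain ⟨W, _, _, _, σ, w, rfl, hw, hσ⟩ := hχ
  obtain ⟨y, hy⟩ := exists_ne (0 : Y)
  obtain ⟨f, hf⟩ : ∃ f : W →ₗ[ℂ] ℂ, ∀ g, f (w g) = if g = 1 then 1 else 0 := by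
    obtain ⟨l, hl⟩ := LinearMap.exists_leftInverse_of_injective
      (Finsupp.linearCombination ℂ w) (LinearMap.ker_eq_bot.2 hw)
    refine ⟨Finsupp.lapply 1 ∘ₗ l, fun g ↦ ?_⟩
    have := LinearMap.congr_fun hl (Finsupp.single g 1)
    simp only [LinearMap.comp_apply, Finsupp.linearCombination_single, one_smul,
      LinearMap.id_apply] at this
    simp [this, Finsupp.single_apply]
  set z : W ⊗[ℂ] Y := ∑ g, w g ⊗ₜ τ g y with hz
  have hz0 : z ≠ 0 := by
    intro h
    have := congrArg ((TensorProduct.lid ℂ Y).toLinearMap ∘ₗ LinearMap.rTensor Y f) h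
    simp [hz, hf] at this
    exact hy this
  have hzinv : z ∈ (σ.tprod τ).invariants := by
    intro h
    simp only [hz, map_sum, Representation.tprod_apply, TensorProduct.map_tmul, hσ]
    refine Fintype.sum_equiv (Equiv.mulLeft h) _ _ fun g ↦ ?_
    simp
  have hne : (Nat.card G : ℂ) ≠ 0 := by simp
  let : Invertible (Nat.card G : ℂ) := invertibleOfNonzero hne
  have key := card_inv_mul_sum_char_eq_finrank (σ.tprod τ)
  rw [char_tensor] at key
  intro h0
  simp only [Pi.mul_apply, h0, mul_zero] at key
  have hfin : Module.finrank ℂ (σ.tprod τ).invariants = 0 := by exact_mod_cast key.symm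
  rw [Submodule.finrank_eq_zero] at hfin
  rw [hfin] at hzinv
  exact hz0 (by simpa using hzinv)

/-- The complex conjugate of a character is a character. -/
theorem exists_representation_character_conj {V : Type} [AddCommGroup V] [Module ℂ V]
    [FiniteDimensional ℂ V] [Nontrivial V] (ρ : Representation ℂ G V) :
    ∃ (W : Type) (_ : AddCommGroup W) (_ : Module ℂ W) (_ : FiniteDimensional ℂ W)
      (_ : Nontrivial W) (σ : Representation ℂ G W),
      ∀ g, σ.character g = starRingEnd ℂ (ρ.character g) := by
  let b := Module.finBasis ℂ V
  have : Nonempty (Fin (Module.finrank ℂ V)) := b.index_nonempty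
  let M : (V →ₗ[ℂ] V) →* Matrix (Fin (Module.finrank ℂ V)) (Fin (Module.finrank ℂ V)) ℂ :=
    MonoidHomClass.toMonoidHom (LinearMap.toMatrixAlgEquiv b)
  refine ⟨Fin (Module.finrank ℂ V) → ℂ, inferInstance, inferInstance, inferInstance, inferInstance,
    (MonoidHomClass.toMonoidHom Matrix.toLinAlgEquiv').comp
      ((MonoidHomClass.toMonoidHom (starRingEnd ℂ).mapMatrix).comp (M.comp ρ)), fun g ↦ ?_⟩
  change LinearMap.trace ℂ _ (Matrix.toLin' ((LinearMap.toMatrix b b (ρ g)).map (starRingEnd ℂ))) =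
    starRingEnd ℂ (LinearMap.trace ℂ V (ρ g))
  rw [Matrix.trace_toLin'_eq, LinearMap.trace_eq_matrix_trace ℂ b, Matrix.trace, Matrix.trace,
    map_sum]
  rfl

end ContainsPermRep

section SymmetricGroup

open Representation Equiv

variable {ι : Type} [Fintype ι] [DecidableEq ι] {V : Type} [AddCommGroup V] [Module ℂ V]

/-- The sum over `j` of the operators by which the permutations `swap c j` act. -/
def sumSwap (σ : Representation ℂ (Perm ι) V) (c : ι) : V →ₗ[ℂ] V := ∑ j, σ (swap c j)

theorem linHom_sumSwap (σ : Representation ℂ (Perm ι) V) (g : Perm ι) (c : ι) :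
    linHom σ σ g (sumSwap σ c) = sumSwap σ (g c) := by
  simp only [sumSwap, map_sum]
  refine Fintype.sum_equiv g _ _ fun j ↦ ?_
  rw [linHom_apply, ← Module.End.mul_eq_comp, ← Module.End.mul_eq_comp, ← map_mul, ← map_mul,
    ← mul_assoc, Equiv.mul_swap_eq_swap_mul, mul_assoc, mul_inv_cancel, mul_one]

theorem sumSwap_linHom_apply (ρ : Representation ℂ (Perm ι) V) {a b c : ι} (hab : a ≠ b)
    (hac : a ≠ c) (hbc : b ≠ c) :
    sumSwap (linHom ρ ρ) c (ρ (swap a b)) = Fintype.card ι • ρ (swap a b) +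
      (ρ (swap c b) - ρ (swap a b)) + (ρ (swap a c) - ρ (swap a b)) := by
  have h : ∀ j, linHom ρ ρ (swap c j) (ρ (swap a b)) = ρ (swap a b) +
      (if j = a then ρ (swap c b) - ρ (swap a b) else 0) +
      (if j = b then ρ (swap a c) - ρ (swap a b) else 0) := by
    intro j
    rw [linHom_apply, ← Module.End.mul_eq_comp, ← Module.End.mul_eq_comp, ← map_mul, ← map_mul,
      ← mul_assoc, Equiv.mul_swap_eq_swap_mul, mul_assoc, mul_inv_cancel, mul_one]
    by_cases hja : j = a
    · subst hja
      simp [hab, swap_apply_of_ne_of_ne hbc hab.symm]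
    · by_cases hjb : j = b
      · subst hjb
        simp [hja, swap_apply_of_ne_of_ne hac hab]
      · simp [hja, hjb, swap_apply_of_ne_of_ne hac (Ne.symm hja),
          swap_apply_of_ne_of_ne hbc (Ne.symm hjb)]
  simp [sumSwap, LinearMap.sum_apply, h, Finset.sum_add_distrib]

theorem sumSwap_linHom_ne (hι : 5 ≤ Fintype.card ι) {ρ : Representation ℂ (Perm ι) V}
    (hρ : Function.Injective ρ) {c d : ι} (hcd : c ≠ d) :
    sumSwap (linHom ρ ρ) c ≠ sumSwap (linHom ρ ρ) d := by
  intro h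
  obtain ⟨a, b, e, ha, hb, he, hab, hae, hbe⟩ :
      ∃ a b e, a ∈ ({c, d}ᶜ : Finset ι) ∧ b ∈ ({c, d}ᶜ : Finset ι) ∧ e ∈ ({c, d}ᶜ : Finset ι) ∧
        a ≠ b ∧ a ≠ e ∧ b ≠ e := by
    rw [← Finset.two_lt_card_iff, Finset.card_compl, Finset.card_pair hcd]
    omega
  simp only [Finset.mem_compl, Finset.mem_insert, Finset.mem_singleton, not_or] at ha hb he
  have key : ∀ x y, x ≠ y → x ≠ c → x ≠ d → y ≠ c → y ≠ d →
      ρ (swap x c) + ρ (swap y c) = ρ (swap x d) + ρ (swap y d) := by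
    intro x y hxy hxc hxd hyc hyd
    have := LinearMap.congr_fun h (ρ (swap x y))
    rw [sumSwap_linHom_apply ρ hxy hxc hyc, sumSwap_linHom_apply ρ hxy hxd hyd, swap_comm c y,
      swap_comm d y] at this
    linear_combination (norm := module) this
  have hab' := key a b hab ha.1 ha.2 hb.1 hb.2
  have hae' := key a e hae ha.1 ha.2 he.1 he.2
  have hbe' := key b e hbe hb.1 hb.2 he.1 he.2
  have hacd : ρ (swap a c) = ρ (swap a d) := by
    linear_combination (norm := module) (1 / 2 : ℂ) • (hab' + hae' - hbe')
  have := congrArg (fun g : Perm ι ↦ g a) (hρ hacd)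
  simp only [swap_apply_left] at this
  exact hcd this

/-- If `α` is afforded by a faithful representation, then `α⁴` contains the natural permutation
character of the symmetric group. -/
theorem containsPermRep_character_pow_four [FiniteDimensional ℂ V] (hι : 5 ≤ Fintype.card ι)
    {ρ : Representation ℂ (Perm ι) V} (hρ : Function.Injective ρ) :
    ContainsPermRep (ρ.character ^ 4) ι := by
  have hV : Nontrivial V := by
    by_contra hV
    rw [not_nontrivial_iff_subsingleton] at hV
    have : Nontrivial ι := Fintype.one_lt_card_iff_nontrivial.1 (by omega)
    obtain ⟨c, d, hcd⟩ := exists_pair_ne ι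
    exact swap_eq_one_iff.not.2 hcd (hρ (Subsingleton.elim _ _))
  have hinv : ∀ g, ρ.character g⁻¹ = ρ.character g := fun g ↦ by
    obtain ⟨h, hh⟩ := isConj_iff.1
      (Perm.isConj_iff_cycleType_eq.2 (Perm.cycleType_inv g).symm : IsConj g g⁻¹)
    rw [← hh, char_conj]
  set σ := linHom ρ ρ with hσ
  set X := sumSwap σ
  obtain ⟨s, hs⟩ : ∃ s : ℂ, ∑ i, (X i + s • 1) ≠ 0 := by
    by_contra! h
    have h0 := h 0
    have h1 := h 1
    simp only [zero_smul, add_zero, one_smul, Finset.sum_add_distrib] at h0 h1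
    rw [h0] at h1
    rw [zero_add, Finset.sum_const, Finset.card_univ, ← Nat.cast_smul_eq_nsmul ℂ, smul_eq_zero,
      Nat.cast_eq_zero] at h1
    exact h1.elim (by omega) one_ne_zero
  have hequiv : ∀ g i, linHom σ σ g (X i + s • 1) = X (g • i) + s • 1 := by
    intro g i
    rw [map_add, linHom_sumSwap, map_smul, linHom_apply, ← Module.End.mul_eq_comp,
      ← Module.End.mul_eq_comp, one_mul, ← map_mul, mul_inv_cancel, map_one]
    rfl
  refine ⟨_, inferInstance, inferInstance, inferInstance, linHom σ σ, fun i ↦ X i + s • 1,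
    ?_, ?_, hequiv⟩
  · ext g
    simp only [hσ, char_linHom, hinv, inv_inv, Pi.pow_apply]
    ring
  · rw [Fintype.linearIndependent_iff]
    intro q hq
    have hconst : ∀ i j, q i = q j := by
      intro i j
      by_contra hij
      have hne : i ≠ j := fun h ↦ hij (h ▸ rfl)
      have hq' := congrArg (linHom σ σ (swap i j)) hq
      simp only [map_sum, map_smul, hequiv, map_zero] at hq'
      have hdiff : (q i - q j) • (X i - X j) = 0 := by
        have hterm : ∀ k, q k • (X k + s • 1) - q k • (X (swap i j • k) + s • 1) =
            (if k = i then q i • (X i - X j) else 0) +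
              (if k = j then q j • (X j - X i) else 0) := by
          intro k
          by_cases hki : k = i
          · subst hki
            simp [hne, ← smul_sub]
          · by_cases hkj : k = j
            · subst hkj
              simp [hki, ← smul_sub]
            · simp [hki, hkj, swap_apply_of_ne_of_ne hki hkj]
        have hsum := congrArg₂ (· - ·) hq hq'
        simp only [← Finset.sum_sub_distrib, hterm, Finset.sum_add_distrib, Finset.sum_ite_eq',
          Finset.mem_univ, if_true, sub_zero] at hsum
        rw [← hsum]
        module
      rcases smul_eq_zero.1 hdiff with h | h
      · exact hij (sub_eq_zero.1 h)
      · exact sumSwap_linHom_ne hι hρ hne (sub_eq_zero.1 h)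
    intro i
    simp only [hconst _ i, ← Finset.smul_sum] at hq
    exact (smul_eq_zero.1 hq).resolve_right hs

end SymmetricGroup

theorem FDRep.nontrivial_of_simple {G : Type} [Group G] (V : FDRep ℂ G) [CategoryTheory.Simple V] :
    Nontrivial V := by
  by_contra h
  rw [not_nontrivial_iff_subsingleton] at h
  apply CategoryTheory.id_nonzero V
  ext x
  exact Subsingleton.elim (α := V) _ _

/-- **Theorem 4 (symmetric groups).** For `n ≥ 5` and `G = S_n`, every faithful irreducible
character `α` of `G` satisfies `diam M(G,α) ≤ 4n − 4`. -/
theorem mckay_diam_symmetricGroup (n : ℕ) (hn : 5 ≤ n)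
    (α : Equiv.Perm (Fin n) → ℂ)
    (hα : IsIrrChar (Equiv.Perm (Fin n)) α)
    (hfaithful : IsFaithfulChar (Equiv.Perm (Fin n)) α) :
    McKayDiamLE (Equiv.Perm (Fin n)) α (4 * n - 4) := by
  intro χ₁ χ₂ ⟨V₁, _, h₁⟩ ⟨V₂, _, h₂⟩
  obtain ⟨V, hV, hchar⟩ := hfaithful
  obtain rfl : V.character = α := funext hchar
  have := V₁.nontrivial_of_simple
  have := V₂.nontrivial_of_simple
  obtain ⟨W, _, _, _, _, σ, hσ⟩ := exists_representation_character_conj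
    (V := V₂) V₂.ρ
  have hperm : ContainsPermRep (V.character ^ 4) (Fin n) :=
    containsPermRep_character_pow_four (ρ := V.ρ) (by simpa using hn) hV
  have hreg : ContainsPermRep ((V.character ^ 4) ^ (n - 1)) (Equiv.Perm (Fin n)) := by
    refine (hperm.pow (n - 1)).comp (fun g i ↦ g (i.castLE (Nat.sub_le n 1))) ?_ fun g j ↦ rfl
    intro g g' h
    have hlt : ∀ x : Fin n, x.val < n - 1 → g x = g' x := fun x hx ↦ congrFun h ⟨x, hx⟩
    ext x : 1
    by_cases hx : x.val < n - 1
    · exact hlt x hx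
    by_contra hgx
    have hne : (g'.symm (g x)).val ≠ x.val := fun h ↦
      hgx (by rw [← g'.apply_symm_apply (g x), Fin.ext h])
    have := hlt (g'.symm (g x)) (by omega)
    rw [g'.apply_symm_apply, g.injective.eq_iff] at this
    exact hne (congrArg _ this)
  refine ⟨4 * (n - 1), by omega, ?_⟩
  have h := hreg.sum_mul_character_ne_zero
    (Representation.tprod (V := V₁) V₁.ρ σ)
  rw [charInner, finsum_eq_sum_of_fintype]
  refine mul_ne_zero (by simp) ?_
  convert h using 2 with g
  simp only [Representation.char_tensor, Pi.mul_apply, hσ, ← h₁, ← h₂, pow_mul, mul_assoc]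
  rfl
end
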